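/- Let F be a continuous centered Gaussian process with covariance ρ. For a partition Π = {0 = t_0 < t_1 < t_2 < …} of [0,∞) with t_j ↑ ∞, set V_Π(t) = Σ_{0 < t_j ≤ t} |F(t_j) − F(t_{j-1})|⁴ and |Π| = sup_j |t_j − t_{j-1}|. Then for every T > 0, E[ sup_{0 ≤ t ≤ T} | V_Π(t) − (6/π) ∫_0^t u(q(s),s)^{-2} ds |² ] → 0 as |Π| → 0. -/

import Mathlib

open MeasureTheory Real Set Filter

/-- The Gaussian heat kernel `p(t,x,y) = (2πt)^{-1/2} exp(-(x-y)²/(2t))`. -/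
noncomputable def heatKernel (t x y : ℝ) : ℝ :=
  (Real.sqrt (2 * Real.pi * t))⁻¹ * Real.exp (-(x - y) ^ 2 / (2 * t))

/-- The density `u(x,t)` of `B(t)`: `f` evolved by the heat semigroup. -/
noncomputable def udens (f : ℝ → ℝ) (x t : ℝ) : ℝ :=
  if t = 0 then f x else ∫ y : ℝ, heatKernel t x y * f y

/-- The covariance function
`ρ(s,t) = (P(B(s) ≤ q(s), B(t) ≤ q(t)) − α²)/(u(q(s),s) u(q(t),t))`. -/
noncomputable def rho {Ω : Type*} [MeasurableSpace Ω] (P : Measure Ω)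
    (B : ℝ → Ω → ℝ) (f : ℝ → ℝ) (q : ℝ → ℝ) (α s t : ℝ) : ℝ :=
  ((P {ω | B s ω ≤ q s ∧ B t ω ≤ q t}).toReal - α ^ 2) /
    (udens f (q s) s * udens f (q t) t)

/-- The quartic variation sum `V_Π(t) = ∑_{0 < t_j ≤ t} |F(t_j) − F(t_{j-1})|⁴` along the
partition `pt`. -/
noncomputable def quarticVar {Ω' : Type*} (F : ℝ → Ω' → ℝ) (pt : ℕ → ℝ) (t : ℝ) (ω : Ω') : ℝ :=
  ∑' j : ℕ, if pt (j + 1) ≤ t then (F (pt (j + 1)) ω - F (pt j) ω) ^ 4 else 0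

section

open ProbabilityTheory

/-- Absolute moments of the standard Gaussian law. -/
lemma integral_abs_pow_gaussianReal_std (k : ℕ) :
    ∫ x, |x| ^ k ∂(gaussianReal 0 1)
      = (√(2 * π))⁻¹ * (2 * ((1 / 2 : ℝ) ^ (-((k : ℝ) + 1) / 2) * (1 / 2)
          * Real.Gamma (((k : ℝ) + 1) / 2))) := by
  rw [integral_gaussianReal_eq_integral_smul (by norm_num)]
  have h1 : ∀ x : ℝ, gaussianPDFReal 0 1 x • |x| ^ k
      = (√(2 * π))⁻¹ * (fun y : ℝ => y ^ (k : ℝ) * rexp (-(1 / 2) * y ^ (2 : ℝ))) |x| := by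
    intro x
    simp only [gaussianPDFReal, smul_eq_mul, NNReal.coe_one, mul_one, sub_zero, rpow_natCast,
      rpow_ofNat, sq_abs]
    have : -x ^ 2 / 2 = -(1 / 2) * x ^ 2 := by ring
    rw [this]; ring
  simp_rw [h1]
  rw [integral_const_mul,
    integral_comp_abs (f := fun y : ℝ => y ^ (k : ℝ) * rexp (-(1 / 2) * y ^ (2 : ℝ))),
    integral_rpow_mul_exp_neg_mul_rpow (by norm_num) (by linarith [k.cast_nonneg (α := ℝ)])
      (by norm_num)]

lemma half_rpow_neg_nat_add_half (n : ℕ) :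
    (1 / 2 : ℝ) ^ (-((n : ℝ) + 1 / 2)) = 2 ^ n * √2 := by
  rw [one_div, inv_rpow (by norm_num), rpow_neg (by norm_num), rpow_add (by norm_num), inv_inv,
    rpow_natCast, ← one_div, ← sqrt_eq_rpow]

lemma integral_abs_gaussianReal_std : ∫ x, |x| ∂(gaussianReal 0 1) = √(2 / π) := by
  have h := integral_abs_pow_gaussianReal_std 1
  simp only [pow_one] at h
  rw [h]
  norm_num
  have h2 : √2 ^ 2 = 2 := sq_sqrt (by norm_num)
  field_simp
  exact h2.symm

lemma integral_pow_four_gaussianReal_std : ∫ x, x ^ 4 ∂(gaussianReal 0 1) = 3 := by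
  have h := integral_abs_pow_gaussianReal_std 4
  have e : ∀ x : ℝ, |x| ^ 4 = x ^ 4 := fun x => by rw [← abs_pow, abs_of_nonneg (by positivity)]
  simp_rw [e] at h
  rw [h]
  have h2 := Real.Gamma_nat_add_half 2
  have h3 : (((4 : ℕ) : ℝ) + 1) / 2 = (2 : ℕ) + 1 / 2 := by norm_num
  rw [h3, h2, neg_div, h3]
  rw [half_rpow_neg_nat_add_half, sqrt_mul (by norm_num)]
  have : √π ≠ 0 := by positivity
  have : (√2) ^ 2 = 2 := sq_sqrt (by norm_num)
  simp [Nat.doubleFactorial]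
  field_simp

lemma integral_pow_eight_gaussianReal_std : ∫ x, x ^ 8 ∂(gaussianReal 0 1) = 105 := by
  have h := integral_abs_pow_gaussianReal_std 8
  have e : ∀ x : ℝ, |x| ^ 8 = x ^ 8 := fun x => by rw [← abs_pow, abs_of_nonneg (by positivity)]
  simp_rw [e] at h
  rw [h]
  have h2 := Real.Gamma_nat_add_half 4
  have h3 : (((8 : ℕ) : ℝ) + 1) / 2 = (4 : ℕ) + 1 / 2 := by norm_num
  rw [h3, h2, neg_div, h3]
  rw [half_rpow_neg_nat_add_half, sqrt_mul (by norm_num)]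
  have : √π ≠ 0 := by positivity
  have : (√2) ^ 2 = 2 := sq_sqrt (by norm_num)
  simp [Nat.doubleFactorial]
  field_simp

/-- Centered Gaussian laws are scaled copies of the standard one. -/
lemma gaussianReal_eq_map_std (v : NNReal) :
    gaussianReal 0 v = (gaussianReal 0 1).map (fun x => √v * x) := by
  rw [gaussianReal_map_const_mul]
  congr 1
  · simp
  · ext; simp

lemma integral_gaussianReal_eq_std (v : NNReal) {g : ℝ → ℝ} (hg : Measurable g) :
    ∫ x, g x ∂(gaussianReal 0 v) = ∫ x, g (√v * x) ∂(gaussianReal 0 1) := by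
  rw [gaussianReal_eq_map_std, integral_map (by fun_prop) hg.aestronglyMeasurable]

lemma integral_pow_four_gaussianReal (v : NNReal) :
    ∫ x, x ^ 4 ∂(gaussianReal 0 v) = 3 * (v : ℝ) ^ 2 := by
  rw [integral_gaussianReal_eq_std v (by fun_prop)]
  simp_rw [mul_pow]
  rw [integral_const_mul, integral_pow_four_gaussianReal_std]
  rw [show (√(v : ℝ)) ^ 4 = ((√(v : ℝ)) ^ 2) ^ 2 by ring, sq_sqrt v.coe_nonneg]; ring

lemma integral_pow_eight_gaussianReal (v : NNReal) :
    ∫ x, x ^ 8 ∂(gaussianReal 0 v) = 105 * (v : ℝ) ^ 4 := by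
  rw [integral_gaussianReal_eq_std v (by fun_prop)]
  simp_rw [mul_pow]
  rw [integral_const_mul, integral_pow_eight_gaussianReal_std]
  rw [show (√(v : ℝ)) ^ 8 = ((√(v : ℝ)) ^ 2) ^ 4 by ring, sq_sqrt v.coe_nonneg]; ring

/-- The centered Gaussian law with variance `τ`. -/
noncomputable def heatLaw (τ : ℝ) : Measure ℝ := gaussianReal 0 τ.toNNReal

instance (τ : ℝ) : IsProbabilityMeasure (heatLaw τ) := by unfold heatLaw; infer_instance

lemma heatLaw_zero : heatLaw 0 = Measure.dirac 0 := by simp [heatLaw, gaussianReal_zero_var]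

lemma integrable_pow_heatLaw (τ : ℝ) (k : ℕ) : Integrable (fun z => z ^ k) (heatLaw τ) :=
  (memLp_id_gaussianReal (μ := 0) (v := τ.toNNReal) (k : NNReal)).integrable_norm_pow' |>.mono
    (by fun_prop) (by simp)

lemma integrable_id_heatLaw (τ : ℝ) : Integrable (fun z : ℝ => z) (heatLaw τ) := by
  simpa using integrable_pow_heatLaw τ 1

lemma integral_id_heatLaw (τ : ℝ) : ∫ z, z ∂(heatLaw τ) = 0 := integral_id_gaussianReal

lemma integral_sq_heatLaw {τ : ℝ} (hτ : 0 ≤ τ) : ∫ z, z ^ 2 ∂(heatLaw τ) = τ := by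
  have h := variance_fun_id_gaussianReal (μ := 0) (v := τ.toNNReal)
  rw [variance_eq_integral (by fun_prop)] at h
  simpa [hτ, heatLaw, integral_id_gaussianReal] using h

lemma integral_comp_neg_heatLaw (τ : ℝ) (g : ℝ → ℝ) :
    ∫ z, g (-z) ∂(heatLaw τ) = ∫ z, g z ∂(heatLaw τ) := by
  have h : (heatLaw τ).map (fun z => -z) = heatLaw τ := by
    unfold heatLaw; rw [gaussianReal_map_neg]; simp
  conv_rhs => rw [← h]
  exact ((MeasurableEquiv.neg ℝ).measurableEmbedding.integral_map g).symm

lemma integral_abs_heatLaw {τ : ℝ} (hτ : 0 ≤ τ) :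
    ∫ z, |z| ∂(heatLaw τ) = √(2 / π) * √τ := by
  unfold heatLaw
  rw [integral_gaussianReal_eq_std _ (by fun_prop)]
  simp_rw [abs_mul]
  rw [integral_const_mul, integral_abs_gaussianReal_std, Real.coe_toNNReal _ hτ,
    abs_of_nonneg (sqrt_nonneg _), mul_comm]

/-- The mean of the positive part of a centered Gaussian variable. -/
lemma integral_posPart_heatLaw {τ : ℝ} (hτ : 0 ≤ τ) :
    ∫ z, max z 0 ∂(heatLaw τ) = √(2 / π) * √τ / 2 := by
  have h : ∀ z : ℝ, max z 0 = (z + |z|) / 2 := fun z => by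
    rcases le_total 0 z with hz | hz
    · rw [max_eq_left hz, abs_of_nonneg hz]; ring
    · rw [max_eq_right hz, abs_of_nonpos hz]; ring
  simp_rw [h]
  rw [integral_div, integral_add (integrable_id_heatLaw τ) (integrable_id_heatLaw τ).abs,
    integral_id_heatLaw, integral_abs_heatLaw hτ, zero_add]

lemma heatLaw_conv {σ τ : ℝ} (hσ : 0 ≤ σ) (hτ : 0 ≤ τ) :
    (heatLaw σ).conv (heatLaw τ) = heatLaw (σ + τ) := by
  unfold heatLaw
  rw [gaussianReal_conv_gaussianReal, Real.toNNReal_add hσ hτ, add_zero]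

/-- The centered Gaussian distribution function. -/
lemma heatLaw_Iic {τ : ℝ} (hτ : 0 < τ) (a : ℝ) :
    (heatLaw τ).real (Iic a) = (heatLaw 1).real (Iic (a / √τ)) := by
  have hs : 0 < √τ := sqrt_pos.2 hτ
  have : heatLaw τ = (heatLaw 1).map (fun x => √τ * x) := by
    have := gaussianReal_eq_map_std τ.toNNReal
    rw [Real.coe_toNNReal _ hτ.le] at this
    simpa [heatLaw] using this
  rw [this, map_measureReal_apply (by fun_prop) measurableSet_Iic]
  congr 1
  ext x
  simp only [mem_preimage, mem_Iic]
  rw [le_div_iff₀ hs, mul_comm]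

lemma heatLaw_one_Iic_sub_le (a b : ℝ) :
    (heatLaw 1).real (Iic b) - (heatLaw 1).real (Iic a) ≤ max (b - a) 0 := by
  rcases le_total b a with h | h
  · exact le_max_of_le_right (by linarith [measureReal_mono (μ := heatLaw 1) (Iic_subset_Iic.2 h)])
  refine le_max_of_le_left ?_
  rw [← measureReal_sdiff (Iic_subset_Iic.2 h) measurableSet_Iic]
  have e : Iic b \ Iic a = Ioc a b := by ext; simp [and_comm]
  rw [e]
  have h1 : heatLaw 1 (Ioc a b) ≤ volume (Ioc a b) := by
    unfold heatLaw
    rw [Real.toNNReal_one, gaussianReal_apply _ (by norm_num)]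
    calc ∫⁻ x in Ioc a b, gaussianPDF 0 1 x ≤ ∫⁻ x in Ioc a b, 1 := by
          refine lintegral_mono fun x => ?_
          rw [gaussianPDF, ← ENNReal.ofReal_one]
          refine ENNReal.ofReal_le_ofReal ?_
          rw [gaussianPDFReal]
          refine mul_le_one₀ (inv_le_one_of_one_le₀ ?_) (by positivity) (exp_le_one_iff.2 ?_)
          · rw [one_le_sqrt]; simp; linarith [pi_gt_three]
          · have := sq_nonneg x; simp; linarith
      _ = volume (Ioc a b) := by simp
  rw [Real.volume_Ioc] at h1
  exact ENNReal.toReal_le_of_le_ofReal (by linarith) h1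

/-- A probability density on `ℝ` which is bounded, Lipschitz and has quadratically small symmetric
second differences, all with the constant `C`. -/
structure RegularDensity (g : ℝ → ℝ) (C : ℝ) : Prop where
  nonneg : ∀ x, 0 ≤ g x
  le : ∀ x, g x ≤ C
  lip : ∀ x y, |g x - g y| ≤ C * |x - y|
  second : ∀ x z, |g (x - z) + g (x + z) - 2 * g x| ≤ C * z ^ 2
  integrable : Integrable g
  integral_eq_one : ∫ x, g x = 1

/-- The heat semigroup acting on functions. -/
noncomputable def heatEvolve (τ : ℝ) (g : ℝ → ℝ) (x : ℝ) : ℝ := ∫ z, g (x - z) ∂(heatLaw τ)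

/-- The probability measure with density `g`. -/
noncomputable def densityLaw (g : ℝ → ℝ) : Measure ℝ :=
  volume.withDensity fun x => ENNReal.ofReal (g x)

namespace RegularDensity

variable {g : ℝ → ℝ} {C : ℝ}

lemma const_nonneg (hg : RegularDensity g C) : 0 ≤ C := (hg.nonneg 0).trans (hg.le 0)

lemma continuous (hg : RegularDensity g C) : Continuous g := by
  have : LipschitzWith C.toNNReal g := LipschitzWith.of_dist_le_mul fun x y => by
    rw [Real.coe_toNNReal _ hg.const_nonneg, Real.dist_eq, Real.dist_eq]; exact hg.lip x y
  exact this.continuous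

lemma isProbabilityMeasure (hg : RegularDensity g C) :
    IsProbabilityMeasure (densityLaw g) := by
  constructor
  rw [densityLaw, withDensity_apply _ MeasurableSet.univ, Measure.restrict_univ,
    ← ofReal_integral_eq_lintegral_ofReal hg.integrable (ae_of_all _ hg.nonneg),
    hg.integral_eq_one, ENNReal.ofReal_one]

lemma integrable_comp_sub (hg : RegularDensity g C) (τ x : ℝ) :
    Integrable (fun z => g (x - z)) (heatLaw τ) := by
  have := hg.continuous
  refine Integrable.of_bound (C := C) (by fun_prop) (ae_of_all _ fun z => ?_)
  rw [Real.norm_eq_abs, abs_of_nonneg (hg.nonneg _)]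
  exact hg.le _

lemma densityLaw_heatEvolve (hg : RegularDensity g C) (τ : ℝ) :
    densityLaw (heatEvolve τ g) = (densityLaw g).conv (heatLaw τ) := by
  have hc := hg.continuous
  have hP := hg.isProbabilityMeasure
  ext A hA
  have hind : Measurable (A.indicator (1 : ℝ → ENNReal)) := measurable_one.indicator hA
  have hinner : Measurable fun x => ∫⁻ y, A.indicator (1 : ℝ → ENNReal) (x + y) ∂(heatLaw τ) :=
    (hind.comp measurable_add).lintegral_prod_right'
  rw [← lintegral_indicator_one hA (μ := (densityLaw g).conv (heatLaw τ)),
    Measure.lintegral_conv hind, densityLaw, densityLaw,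
    lintegral_withDensity_eq_lintegral_mul _ (by fun_prop) hinner, withDensity_apply _ hA,
      ← lintegral_indicator hA]
  have h1 : ∀ x, A.indicator (fun a => ENNReal.ofReal (heatEvolve τ g a)) x
      = ∫⁻ z, A.indicator 1 x * ENNReal.ofReal (g (x - z)) ∂(heatLaw τ) := fun x => by
    rw [lintegral_const_mul _ (by fun_prop),
      ← ofReal_integral_eq_lintegral_ofReal (hg.integrable_comp_sub τ x)
        (ae_of_all _ fun z => hg.nonneg _)]
    change _ = _ * ENNReal.ofReal (heatEvolve τ g x)
    by_cases hx : x ∈ A <;> simp [hx]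
  simp_rw [h1]
  rw [lintegral_lintegral_swap
    (((hind.comp measurable_fst).mul (by fun_prop)).aemeasurable)]
  have h2 : ∀ z, ∫⁻ x, A.indicator 1 x * ENNReal.ofReal (g (x - z))
      = ∫⁻ x, A.indicator 1 (x + z) * ENNReal.ofReal (g x) := fun z => by
    rw [← lintegral_add_right_eq_self _ z]
    simp
  simp_rw [h2]
  rw [lintegral_lintegral_swap]
  · refine lintegral_congr fun x => ?_
    rw [lintegral_mul_const _ (by fun_prop), Pi.mul_apply, mul_comm]
  · exact ((hind.comp (measurable_snd.add measurable_fst)).mul (by fun_prop)).aemeasurable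

lemma abs_average_sub_le (φ : ℝ → ℝ) (K a : ℝ) {τ : ℝ} (hτ : 0 ≤ τ)
    (hφ : ∀ z, |φ (a - z) + φ (a + z) - 2 * φ a| ≤ K * z ^ 2)
    (hint : Integrable (fun z => φ (a - z)) (heatLaw τ))
    (hint' : Integrable (fun z => φ (a + z)) (heatLaw τ)) :
    |∫ z, φ (a - z) ∂(heatLaw τ) - φ a| ≤ K * τ / 2 := by
  have h1 : ∫ z, φ (a + z) ∂(heatLaw τ) = ∫ z, φ (a - z) ∂(heatLaw τ) := by
    rw [← integral_comp_neg_heatLaw]; simp [sub_eq_add_neg]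
  have h2 : ∫ z, (φ (a - z) + φ (a + z) - 2 * φ a) ∂(heatLaw τ)
      = 2 * (∫ z, φ (a - z) ∂(heatLaw τ) - φ a) := by
    rw [integral_sub (f := fun z => φ (a - z) + φ (a + z)) (hint.add hint') (integrable_const _),
      integral_add hint hint', h1]
    simp; ring
  have h3 : |∫ z, (φ (a - z) + φ (a + z) - 2 * φ a) ∂(heatLaw τ)| ≤ K * τ := by
    rw [← integral_sq_heatLaw hτ, ← integral_const_mul, integral_sq_heatLaw hτ]
    exact norm_integral_le_of_norm_le ((integrable_pow_heatLaw τ 2).const_mul K)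
      (ae_of_all _ fun z => (Real.norm_eq_abs _).trans_le (hφ z))
  rw [h2, abs_mul, abs_two] at h3
  linarith

lemma heatEvolve_regular (hg : RegularDensity g C) (τ : ℝ) :
    RegularDensity (heatEvolve τ g) C := by
  have hi := hg.integrable_comp_sub τ
  have hP := hg.isProbabilityMeasure
  have hnn : ∀ x, 0 ≤ heatEvolve τ g x := fun x => integral_nonneg fun z => hg.nonneg _
  have hlip : ∀ x y, |heatEvolve τ g x - heatEvolve τ g y| ≤ C * |x - y| := fun x y => by
    simp only [heatEvolve]
    rw [← integral_sub (hi x) (hi y), ← Real.norm_eq_abs]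
    refine (norm_integral_le_of_norm_le_const (C := C * |x - y|)
      (ae_of_all _ fun z => ?_)).trans (by simp)
    simpa using hg.lip (x - z) (y - z)
  have hcont : Continuous (heatEvolve τ g) := by
    have : LipschitzWith C.toNNReal (heatEvolve τ g) := LipschitzWith.of_dist_le_mul fun x y => by
      rw [Real.coe_toNNReal _ hg.const_nonneg, Real.dist_eq, Real.dist_eq]; exact hlip x y
    exact this.continuous
  have hl : ∫⁻ x, ENNReal.ofReal (heatEvolve τ g x) = 1 := by
    have h := congrArg (fun μ : Measure ℝ => μ univ) (hg.densityLaw_heatEvolve τ)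
    simpa [densityLaw, withDensity_apply] using
      h.trans (measure_univ (μ := (densityLaw g).conv (heatLaw τ)))
  refine ⟨hnn, fun x => ?_, hlip, fun x z => ?_, ?_, ?_⟩
  · calc heatEvolve τ g x ≤ ∫ z, C ∂(heatLaw τ) :=
          integral_mono (hi x) (integrable_const _) fun z => hg.le _
      _ = C := by simp
  · simp only [heatEvolve]
    rw [← integral_const_mul, ← integral_add (hi _) (hi _),
      ← integral_sub (f := fun w => g (x - z - w) + g (x + z - w)) ((hi _).add (hi _))
        ((hi _).const_mul 2), ← Real.norm_eq_abs]
    refine (norm_integral_le_of_norm_le_const (C := C * z ^ 2)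
      (ae_of_all _ fun w => ?_)).trans (by simp)
    have := hg.second (x - w) z
    rwa [Real.norm_eq_abs, sub_right_comm x z w, add_sub_right_comm x z w]
  · refine ⟨hcont.aestronglyMeasurable, ?_⟩
    rw [hasFiniteIntegral_iff_ofReal (ae_of_all _ hnn), hl]
    exact ENNReal.one_lt_top
  · rw [integral_eq_lintegral_of_nonneg_ae (ae_of_all _ hnn) hcont.aestronglyMeasurable, hl]
    simp

lemma heatEvolve_heatEvolve (hg : RegularDensity g C) {σ τ : ℝ} (hσ : 0 ≤ σ) (hτ : 0 ≤ τ)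
    (x : ℝ) : heatEvolve τ (heatEvolve σ g) x = heatEvolve (τ + σ) g x := by
  unfold heatEvolve
  rw [← heatLaw_conv hτ hσ, integral_conv]
  · simp_rw [sub_sub]
  · rw [heatLaw_conv hτ hσ]; exact hg.integrable_comp_sub _ x

lemma abs_heatEvolve_sub_le (hg : RegularDensity g C) {τ : ℝ} (hτ : 0 ≤ τ) (x : ℝ) :
    |heatEvolve τ g x - g x| ≤ C * τ / 2 := by
  refine abs_average_sub_le g C x hτ (hg.second x) (hg.integrable_comp_sub τ x) ?_
  have := hg.continuous
  refine Integrable.of_bound (C := C) (by fun_prop) (ae_of_all _ fun z => ?_)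
  rw [Real.norm_eq_abs, abs_of_nonneg (hg.nonneg _)]
  exact hg.le _

lemma abs_intervalIntegral_sub_le (hg : RegularDensity g C) (a b : ℝ) :
    |(∫ x in a..b, g x) - (b - a) * g a| ≤ C * (b - a) ^ 2 := by
  have h : (b - a) * g a = ∫ x in a..b, g a := by simp
  rw [h, ← intervalIntegral.integral_sub (hg.continuous.intervalIntegrable _ _) (by simp)]
  have := intervalIntegral.norm_integral_le_of_norm_le_const (a := a) (b := b)
    (f := fun x => g x - g a) (C := C * |b - a|) (fun x hx => (hg.lip x a).trans ?_)
  · rw [Real.norm_eq_abs, mul_assoc, abs_mul_abs_self] at this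
    rwa [pow_two]
  · refine mul_le_mul_of_nonneg_left ?_ hg.const_nonneg
    exact abs_sub_left_of_mem_uIcc (uIoc_subset_uIcc hx)

lemma measureReal_densityLaw (hg : RegularDensity g C) {A : Set ℝ} (hA : MeasurableSet A) :
    (densityLaw g).real A = ∫ x in A, g x := by
  rw [measureReal_def, densityLaw, withDensity_apply _ hA,
    integral_eq_lintegral_of_nonneg_ae (ae_of_all _ hg.nonneg) hg.continuous.aestronglyMeasurable]

lemma cdf_sub (hg : RegularDensity g C) (a b : ℝ) :
    (∫ x in Iic b, g x) - ∫ x in Iic a, g x = ∫ x in a..b, g x :=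
  intervalIntegral.integral_Iic_sub_Iic hg.integrable.integrableOn hg.integrable.integrableOn

lemma abs_cdf_heatEvolve_sub_le (hg : RegularDensity g C) {τ : ℝ} (hτ : 0 ≤ τ) (a : ℝ) :
    |(∫ x in Iic a, heatEvolve τ g x) - ∫ x in Iic a, g x| ≤ C * τ := by
  have hP := hg.isProbabilityMeasure
  set H : ℝ → ℝ := fun b => ∫ x in Iic b, g x with hH
  have hHm : Monotone H := fun b c hbc => by
    have := hg.cdf_sub b c
    have h0 : 0 ≤ ∫ x in b..c, g x :=
      intervalIntegral.integral_nonneg hbc fun x _ => hg.nonneg x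
    simp only [hH]; linarith
  have hHmeas : Measurable H := hHm.measurable
  have hHb : ∀ b, ‖H b‖ ≤ 1 := fun b => by
    rw [hH]; simp only
    rw [← hg.measureReal_densityLaw measurableSet_Iic, Real.norm_eq_abs,
      abs_of_nonneg measureReal_nonneg]
    exact measureReal_le_one
  have h1 : ∫ x in Iic a, heatEvolve τ g x = ∫ z, H (a - z) ∂(heatLaw τ) := by
    rw [← (hg.heatEvolve_regular τ).measureReal_densityLaw measurableSet_Iic,
      hg.densityLaw_heatEvolve τ, Measure.conv_comm, ← integral_indicator_one measurableSet_Iic,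
      integral_conv (f := (Iic a).indicator 1)
        ((integrable_const (1 : ℝ)).indicator measurableSet_Iic)]
    refine integral_congr_ae (ae_of_all _ fun z => ?_)
    simp only [hH]
    rw [← hg.measureReal_densityLaw measurableSet_Iic, ← integral_indicator_one measurableSet_Iic]
    refine integral_congr_ae (ae_of_all _ fun y => ?_)
    simp only [indicator, mem_Iic, Pi.one_apply]
    simp [le_sub_iff_add_le, add_comm]
  rw [h1]
  have key := abs_average_sub_le H (2 * C) a hτ (fun z => ?_)
    (Integrable.of_bound (C := 1)
      (hHmeas.comp (measurable_const.sub measurable_id)).aestronglyMeasurable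
      (ae_of_all _ fun z => hHb _))
    (Integrable.of_bound (C := 1)
      (hHmeas.comp (measurable_const.add measurable_id)).aestronglyMeasurable
      (ae_of_all _ fun z => hHb _))
  · calc _ ≤ _ := key
      _ = C * τ := by ring
  · have e1 := hg.cdf_sub a (a - z)
    have e2 := hg.cdf_sub a (a + z)
    have b1 := abs_le.1 (hg.abs_intervalIntegral_sub_le a (a - z))
    have b2 := abs_le.1 (hg.abs_intervalIntegral_sub_le a (a + z))
    have r1 : (a - z - a) ^ 2 = z ^ 2 := by ring
    have r2 : (a + z - a) ^ 2 = z ^ 2 := by ring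
    rw [r1] at b1
    rw [r2] at b2
    simp only [hH]
    rw [abs_le]
    constructor <;> nlinarith [b1.1, b1.2, b2.1, b2.2]

end RegularDensity

lemma SchwartzMap.exists_regularDensity (f : SchwartzMap ℝ ℝ) (hf : ∀ x, 0 ≤ f x)
    (hf1 : ∫ x, f x = 1) : ∃ C, RegularDensity f C := by
  obtain ⟨C0, h0⟩ : ∃ C, ∀ x, ‖f x‖ ≤ C := ⟨_, f.norm_le_seminorm ℝ⟩
  obtain ⟨C1, h1⟩ : ∃ C, ∀ x, ‖deriv f x‖ ≤ C :=
    ⟨_, (SchwartzMap.derivCLM ℝ ℝ f).norm_le_seminorm ℝ⟩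
  obtain ⟨C2, h2⟩ : ∃ C, ∀ x, ‖deriv (deriv f) x‖ ≤ C := by
    refine ⟨_, fun x => le_trans (le_of_eq ?_)
      ((SchwartzMap.derivCLM ℝ ℝ (SchwartzMap.derivCLM ℝ ℝ f)).norm_le_seminorm ℝ x)⟩
    rw [SchwartzMap.derivCLM_apply]
    rfl
  have hd : Differentiable ℝ f := f.differentiable
  have hd1 : Differentiable ℝ (deriv f) := (SchwartzMap.derivCLM ℝ ℝ f).differentiable
  have lip : ∀ x y, |f x - f y| ≤ C1 * |x - y| := fun x y =>
    convex_univ.norm_image_sub_le_of_norm_deriv_le (fun z _ => hd z) (fun z _ => h1 z)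
      (mem_univ y) (mem_univ x)
  have lip1 : ∀ x y, |deriv f x - deriv f y| ≤ C2 * |x - y| := fun x y =>
    convex_univ.norm_image_sub_le_of_norm_deriv_le (fun z _ => hd1 z) (fun z _ => h2 z)
      (mem_univ y) (mem_univ x)
  have p2 : 0 ≤ C2 := (norm_nonneg _).trans (h2 0)
  have sec : ∀ x z, |f (x - z) + f (x + z) - 2 * f x| ≤ 2 * C2 * z ^ 2 := fun x z => by
    have hder : ∀ w, HasDerivAt (fun w => f (x - w) + f (x + w))
        (deriv f (x - w) * (-1) + deriv f (x + w) * 1) w := fun w =>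
      ((hd (x - w)).hasDerivAt.comp w ((hasDerivAt_id w).const_sub x)).add
        ((hd (x + w)).hasDerivAt.comp w ((hasDerivAt_id w).const_add x))
    have := (convex_uIcc (0 : ℝ) z).norm_image_sub_le_of_norm_hasDerivWithin_le
      (f := fun w => f (x - w) + f (x + w)) (C := 2 * C2 * |z|)
      (fun w _ => (hder w).hasDerivWithinAt) (fun w hw => ?_) left_mem_uIcc right_mem_uIcc
    · simp only [sub_zero, add_zero, Real.norm_eq_abs] at this
      rw [mul_assoc, abs_mul_abs_self, ← pow_two] at this
      convert this using 2
      ring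
    · have h := lip1 (x + w) (x - w)
      have hw' : |w| ≤ |z| := by simpa using abs_sub_left_of_mem_uIcc hw
      rw [show x + w - (x - w) = 2 * w by ring, abs_mul, abs_two] at h
      rw [Real.norm_eq_abs, show deriv f (x - w) * (-1) + deriv f (x + w) * 1
        = deriv f (x + w) - deriv f (x - w) by ring]
      nlinarith
  have q0 : 0 ≤ C0 := (norm_nonneg _).trans (h0 0)
  have q1 : 0 ≤ C1 := (norm_nonneg _).trans (h1 0)
  refine ⟨C0 + C1 + 2 * C2, hf, fun x => ?_, fun x y => ?_, fun x z => ?_, f.integrable, hf1⟩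
  · have := h0 x; rw [Real.norm_eq_abs] at this; linarith [le_abs_self (f x)]
  · refine (lip x y).trans (mul_le_mul_of_nonneg_right (by linarith) (abs_nonneg _))
  · exact (sec x z).trans (mul_le_mul_of_nonneg_right (by linarith) (sq_nonneg _))

lemma udens_eq_heatEvolve (f : ℝ → ℝ) {t : ℝ} (ht : 0 ≤ t) (x : ℝ) :
    udens f x t = heatEvolve t f x := by
  rcases ht.eq_or_lt with rfl | ht
  · simp [udens, heatEvolve, heatLaw_zero]
  · rw [udens, if_neg ht.ne', heatEvolve, heatLaw,
      integral_gaussianReal_eq_integral_smul (by simpa),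
      ← integral_sub_left_eq_self _ volume x]
    simp [heatKernel, gaussianPDFReal, ht.le]

lemma udens_pos {f : ℝ → ℝ} {C : ℝ} (hf : RegularDensity f C) {t : ℝ} (ht : 0 < t) (x : ℝ) :
    0 < udens f x t := by
  have hk : ∀ y, 0 < heatKernel t x y := fun y => by unfold heatKernel; positivity
  rw [udens, if_neg ht.ne', integral_pos_iff_support_of_nonneg
    (fun y => mul_nonneg (hk y).le (hf.nonneg y))]
  · have : Function.support (fun y => heatKernel t x y * f y) = Function.support f := by
      ext y; simp [(hk y).ne']
    rw [this, ← integral_pos_iff_support_of_nonneg hf.nonneg hf.integrable, hf.integral_eq_one]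
    exact one_pos
  · have hc : Continuous (fun y => heatKernel t x y) := by unfold heatKernel; fun_prop
    refine hf.integrable.bdd_mul (c := (√(2 * π * t))⁻¹) hc.aestronglyMeasurable
      (ae_of_all _ fun y => ?_)
    rw [Real.norm_eq_abs, abs_of_pos (hk y), heatKernel]
    refine mul_le_of_le_one_right (by positivity) (exp_le_one_iff.2 ?_)
    exact div_nonpos_of_nonpos_of_nonneg (by nlinarith [sq_nonneg (x - y)]) (by linarith)

/-- If the mass of a regular density between `a` and `b` is small, then `b` is close to `a`. -/
lemma RegularDensity.abs_sub_le_of_abs_integral_le {g : ℝ → ℝ} {C : ℝ} (hg : RegularDensity g C)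
    {a b c e : ℝ} (hc : 0 < c) (hca : c ≤ g a) (hab : |∫ x in a..b, g x| ≤ e)
    (he : 4 * C * e < c ^ 2) : |b - a| ≤ 2 * e / c := by
  have hC : 0 < C := hc.trans_le (hca.trans (hg.le a))
  by_contra! hlt
  rw [div_lt_iff₀ hc] at hlt
  have he0 : 0 ≤ e := (abs_nonneg _).trans hab
  have hii : ∀ x y, IntervalIntegrable g volume x y := fun x y =>
    hg.continuous.intervalIntegrable x y
  obtain ⟨h, hh0, hhb, hhC, hhe⟩ : ∃ h, 0 ≤ h ∧ h ≤ |b - a| ∧ C * h ≤ c / 2 ∧ 2 * e < h * c := by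
    refine ⟨min |b - a| (c / (2 * C)), le_min (abs_nonneg _) (by positivity), min_le_left _ _,
      ?_, ?_⟩
    · calc C * min |b - a| (c / (2 * C)) ≤ C * (c / (2 * C)) :=
            mul_le_mul_of_nonneg_left (min_le_right _ _) hC.le
        _ = c / 2 := by field_simp
    · rw [min_mul_of_nonneg _ _ hc.le]
      refine lt_min hlt ?_
      rw [div_mul_eq_mul_div, lt_div_iff₀ (by positivity)]
      nlinarith
  have hmass : h * c / 2 ≤ e := by
    rcases le_total a b with hle | hle
    · rw [abs_of_nonneg (sub_nonneg.2 hle)] at hhb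
      have h1 := abs_le.1 (hg.abs_intervalIntegral_sub_le a (a + h))
      have h2 : 0 ≤ ∫ x in (a + h)..b, g x :=
        intervalIntegral.integral_nonneg (by linarith) fun x _ => hg.nonneg x
      have h3 := intervalIntegral.integral_add_adjacent_intervals (hii a (a + h)) (hii (a + h) b)
      rw [add_sub_cancel_left] at h1
      nlinarith [(abs_le.1 hab).2, h1.1, mul_le_mul_of_nonneg_left hca hh0,
        mul_le_mul_of_nonneg_left hhC hh0]
    · rw [abs_of_nonpos (sub_nonpos.2 hle)] at hhb
      have h1 := abs_le.1 (hg.abs_intervalIntegral_sub_le a (a - h))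
      have h2 : 0 ≤ ∫ x in b..(a - h), g x :=
        intervalIntegral.integral_nonneg (by linarith) fun x _ => hg.nonneg x
      have h3 := intervalIntegral.integral_add_adjacent_intervals (hii a (a - h)) (hii (a - h) b)
      rw [intervalIntegral.integral_symm] at h2
      rw [show a - h - a = -h by ring] at h1
      nlinarith [(abs_le.1 hab).1, h1.2, mul_le_mul_of_nonneg_left hca hh0,
        mul_le_mul_of_nonneg_left hhC hh0]
  linarith

section Quantile

variable {f : ℝ → ℝ} {C : ℝ}

lemma abs_heatEvolve_sub_heatEvolve_le (hf : RegularDensity f C) {s t : ℝ} (hs : 0 ≤ s)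
    (ht : 0 ≤ t) (x : ℝ) : |heatEvolve t f x - heatEvolve s f x| ≤ C * |t - s| := by
  wlog hst : s ≤ t generalizing s t
  · rw [abs_sub_comm, abs_sub_comm t]; exact this ht hs (le_of_not_ge hst)
  have h := (hf.heatEvolve_regular s).abs_heatEvolve_sub_le (sub_nonneg.2 hst) x
  rw [hf.heatEvolve_heatEvolve hs (sub_nonneg.2 hst), sub_add_cancel] at h
  rw [abs_of_nonneg (sub_nonneg.2 hst)]
  nlinarith [mul_nonneg hf.const_nonneg (sub_nonneg.2 hst)]

lemma abs_cdf_heatEvolve_sub_cdf_heatEvolve_le (hf : RegularDensity f C) {s t : ℝ} (hs : 0 ≤ s)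
    (ht : 0 ≤ t) (a : ℝ) :
    |(∫ x in Iic a, heatEvolve t f x) - ∫ x in Iic a, heatEvolve s f x| ≤ C * |t - s| := by
  wlog hst : s ≤ t generalizing s t
  · rw [abs_sub_comm, abs_sub_comm t]; exact this ht hs (le_of_not_ge hst)
  have h := (hf.heatEvolve_regular s).abs_cdf_heatEvolve_sub_le (sub_nonneg.2 hst) a
  simp_rw [hf.heatEvolve_heatEvolve hs (sub_nonneg.2 hst), sub_add_cancel] at h
  rwa [abs_of_nonneg (sub_nonneg.2 hst)]

variable {q : ℝ → ℝ} {α : ℝ}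

lemma abs_quantile_sub_le (hf : RegularDensity f C)
    (hq : ∀ t, 0 ≤ t → ∫ x in Iic (q t), heatEvolve t f x = α) {s t c : ℝ} (hs : 0 ≤ s)
    (ht : 0 ≤ t) (hc : 0 < c) (hcs : c ≤ heatEvolve s f (q s))
    (hst : 4 * C * (C * |t - s|) < c ^ 2) : |q t - q s| ≤ 2 * (C * |t - s|) / c := by
  have hg := hf.heatEvolve_regular s
  refine hg.abs_sub_le_of_abs_integral_le hc hcs ?_ hst
  rw [← hg.cdf_sub, hq s hs, ← hq t ht, abs_sub_comm]
  exact abs_cdf_heatEvolve_sub_cdf_heatEvolve_le hf hs ht _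

lemma abs_density_quantile_sub_le (hf : RegularDensity f C) {s t : ℝ} (hs : 0 ≤ s)
    (ht : 0 ≤ t) : |heatEvolve t f (q t) - heatEvolve s f (q s)|
      ≤ C * |t - s| + C * |q t - q s| := by
  have h1 := abs_heatEvolve_sub_heatEvolve_le hf hs ht (q t)
  have h2 := (hf.heatEvolve_regular s).lip (q t) (q s)
  calc _ = |(heatEvolve t f (q t) - heatEvolve s f (q t))
        + (heatEvolve s f (q t) - heatEvolve s f (q s))| := by ring_nf
    _ ≤ _ := (abs_add_le _ _).trans (add_le_add h1 h2)

lemma continuousOn_quantile (hf : RegularDensity f C)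
    (hq : ∀ t, 0 ≤ t → ∫ x in Iic (q t), heatEvolve t f x = α)
    (hpos : ∀ t, 0 ≤ t → 0 < heatEvolve t f (q t)) : ContinuousOn q (Ici 0) := by
  intro s hs
  have hv := hpos s hs
  have hlim : Tendsto (fun t => |t - s|) (nhdsWithin s (Ici 0)) (nhds 0) := by
    have : ContinuousWithinAt (fun t => |t - s|) (Ici 0) s := by fun_prop
    simpa [ContinuousWithinAt] using this
  have hsmall : ∀ᶠ t in nhdsWithin s (Ici 0),
      4 * C * (C * |t - s|) < heatEvolve s f (q s) ^ 2 := by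
    have : Tendsto (fun t => 4 * C * (C * |t - s|)) (nhdsWithin s (Ici 0)) (nhds 0) := by
      simpa using (hlim.const_mul C).const_mul (4 * C)
    exact this.eventually (gt_mem_nhds (by positivity))
  rw [ContinuousWithinAt, tendsto_iff_dist_tendsto_zero]
  refine squeeze_zero' (Eventually.of_forall fun t => dist_nonneg)
    (g := fun t => 2 * (C * |t - s|) / heatEvolve s f (q s)) ?_ ?_
  · filter_upwards [hsmall, self_mem_nhdsWithin] with t h1 ht
    exact abs_quantile_sub_le hf hq hs ht hv le_rfl h1
  · simpa using ((hlim.const_mul C).const_mul 2).div_const (heatEvolve s f (q s))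

lemma continuousOn_density_quantile (hf : RegularDensity f C)
    (hq : ∀ t, 0 ≤ t → ∫ x in Iic (q t), heatEvolve t f x = α)
    (hpos : ∀ t, 0 ≤ t → 0 < heatEvolve t f (q t)) :
    ContinuousOn (fun t => heatEvolve t f (q t)) (Ici 0) := by
  intro s hs
  have hqs := continuousOn_quantile hf hq hpos s hs
  rw [ContinuousWithinAt, tendsto_iff_dist_tendsto_zero]
  refine squeeze_zero' (Eventually.of_forall fun t => dist_nonneg)
    (g := fun t => C * |t - s| + C * |q t - q s|) ?_ ?_
  · filter_upwards [self_mem_nhdsWithin] with t ht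
    exact abs_density_quantile_sub_le hf hs ht
  · have : ContinuousWithinAt (fun t => C * |t - s| + C * |q t - q s|) (Ici 0) s := by fun_prop
    simpa [ContinuousWithinAt] using this

/-- On compact time intervals the quantile and the inverse of the density at the quantile are
bounded and Lipschitz. -/
lemma exists_quantile_bounds (hf : RegularDensity f C)
    (hq : ∀ t, 0 ≤ t → ∫ x in Iic (q t), heatEvolve t f x = α)
    (hpos : ∀ t, 0 ≤ t → 0 < heatEvolve t f (q t)) {T : ℝ} (hT : 0 < T) :
    ∃ K, 0 < K ∧ ∀ s ∈ Icc 0 T, ∀ t ∈ Icc 0 T, |q t - q s| ≤ K * |t - s|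
      ∧ (heatEvolve s f (q s))⁻¹ ≤ K
      ∧ |(heatEvolve t f (q t))⁻¹ - (heatEvolve s f (q s))⁻¹| ≤ K * |t - s| := by
  have hne : (Icc (0 : ℝ) T).Nonempty := nonempty_Icc.2 hT.le
  obtain ⟨t0, ht0, hmin⟩ := isCompact_Icc.exists_isMinOn hne
    ((continuousOn_density_quantile hf hq hpos).mono Icc_subset_Ici_self)
  set c := heatEvolve t0 f (q t0) with hc
  have hc0 : 0 < c := hpos t0 ht0.1
  have hcv : ∀ s ∈ Icc 0 T, c ≤ heatEvolve s f (q s) := fun s hs => hmin hs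
  have hC : 0 < C := hc0.trans_le ((hf.heatEvolve_regular t0).le _)
  obtain ⟨Q, hQ⟩ := isCompact_Icc.exists_bound_of_continuousOn
    ((continuousOn_quantile hf hq hpos).mono (Icc_subset_Ici_self : Icc 0 T ⊆ Ici 0))
  have hQ0 : 0 ≤ Q := (norm_nonneg _).trans (hQ 0 (left_mem_Icc.2 hT.le))
  have hqL : ∀ s ∈ Icc 0 T, ∀ t ∈ Icc 0 T,
      |q t - q s| ≤ (2 * C / c + 8 * Q * C ^ 2 / c ^ 2) * |t - s| := by
    intro s hs t ht
    have hx := abs_nonneg (t - s)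
    rcases lt_or_ge (4 * C * (C * |t - s|)) (c ^ 2) with h | h
    · refine (abs_quantile_sub_le hf hq hs.1 ht.1 hc0 (hcv s hs) h).trans ?_
      rw [add_mul]
      have : 0 ≤ 8 * Q * C ^ 2 / c ^ 2 * |t - s| := by positivity
      calc _ = 2 * C / c * |t - s| := by ring
        _ ≤ _ := by linarith
    · have h1 : |q t - q s| ≤ 2 * Q := by
        have h2 := hQ s hs
        have h3 := hQ t ht
        simp only [Real.norm_eq_abs] at h2 h3
        linarith [abs_sub (q t) (q s)]
      have h4 : 2 * Q ≤ 8 * Q * C ^ 2 / c ^ 2 * |t - s| := by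
        rw [div_mul_eq_mul_div, le_div_iff₀ (by positivity)]
        nlinarith
      have : 0 ≤ 2 * C / c * |t - s| := by positivity
      linarith
  set L := 2 * C / c + 8 * Q * C ^ 2 / c ^ 2 with hL
  have hL0 : 0 < L := by positivity
  refine ⟨L + c⁻¹ + (C + C * L) / c ^ 2, by positivity, fun s hs t ht => ⟨?_, ?_, ?_⟩⟩
  · refine (hqL s hs t ht).trans (mul_le_mul_of_nonneg_right ?_ (abs_nonneg _))
    have : 0 < c⁻¹ + (C + C * L) / c ^ 2 := by positivity
    linarith
  · refine (inv_anti₀ hc0 (hcv s hs)).trans ?_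
    have : 0 < L + (C + C * L) / c ^ 2 := by positivity
    linarith
  · have hvs := hcv s hs
    have hvt := hcv t ht
    have h1 := abs_density_quantile_sub_le (q := q) hf hs.1 ht.1
    have h2 := mul_le_mul_of_nonneg_left (hqL s hs t ht) hC.le
    have ps := hc0.trans_le hvs
    have pt := hc0.trans_le hvt
    rw [inv_sub_inv pt.ne' ps.ne', abs_div, abs_of_pos (mul_pos pt ps), abs_sub_comm]
    calc _ ≤ ((C + C * L) * |t - s|) / (c * c) := by
          refine div_le_div₀ (by positivity) (by linarith) (by positivity) ?_
          exact mul_le_mul hvt hvs hc0.le pt.le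
      _ = (C + C * L) / c ^ 2 * |t - s| := by ring
      _ ≤ _ := mul_le_mul_of_nonneg_right (by linarith [inv_pos.2 hc0]) (abs_nonneg _)

end Quantile

/-- The indicator function of `(-∞, a]`. -/
noncomputable def belowInd (a x : ℝ) : ℝ := if x ≤ a then 1 else 0

@[fun_prop]
lemma measurable_belowInd (a : ℝ) : Measurable (belowInd a) :=
  Measurable.ite measurableSet_Iic measurable_const measurable_const

lemma belowInd_nonneg (a x : ℝ) : 0 ≤ belowInd a x := by unfold belowInd; split_ifs <;> norm_num

lemma belowInd_le_one (a x : ℝ) : belowInd a x ≤ 1 := by unfold belowInd; split_ifs <;> norm_num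

lemma norm_belowInd_le (a x : ℝ) : ‖belowInd a x‖ ≤ 1 := by
  rw [Real.norm_eq_abs, abs_of_nonneg (belowInd_nonneg a x)]; exact belowInd_le_one a x

lemma belowInd_eq_indicator (a : ℝ) : belowInd a = (Iic a).indicator 1 := by
  ext x; simp [belowInd, indicator]

lemma integral_belowInd (μ : Measure ℝ) (a : ℝ) : ∫ x, belowInd a x ∂μ = μ.real (Iic a) := by
  rw [belowInd_eq_indicator, integral_indicator_one measurableSet_Iic]

lemma integral_belowInd_add (μ : Measure ℝ) (a x : ℝ) :
    ∫ z, belowInd a (x + z) ∂μ = μ.real (Iic (a - x)) := by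
  rw [← integral_belowInd]
  simp [belowInd, le_sub_iff_add_le, add_comm]

section

variable {f : ℝ → ℝ} {C : ℝ}

lemma densityLaw_heatEvolve_eq_conv (hf : RegularDensity f C) {s t : ℝ} (hs : 0 ≤ s)
    (hst : s ≤ t) : densityLaw (heatEvolve t f)
      = (densityLaw (heatEvolve s f)).conv (heatLaw (t - s)) := by
  rw [← (hf.heatEvolve_regular s).densityLaw_heatEvolve]
  congr 1
  ext x
  rw [hf.heatEvolve_heatEvolve hs (sub_nonneg.2 hst), sub_add_cancel]

/-- The probability that a Brownian motion with initial density `f` lies below `q` at the two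
times `s ≤ t`. -/
noncomputable def coProb (f q : ℝ → ℝ) (s t : ℝ) : ℝ :=
  ∫ p, belowInd (q s) p.1 * belowInd (q t) (p.1 + p.2)
    ∂((densityLaw (heatEvolve s f)).prod (heatLaw (t - s)))

variable {q : ℝ → ℝ} {α : ℝ}

lemma integral_belowInd_fst (hf : RegularDensity f C)
    (hq : ∀ t, 0 ≤ t → ∫ x in Iic (q t), heatEvolve t f x = α) {s : ℝ} (hs : 0 ≤ s) (t : ℝ) :
    ∫ p, belowInd (q s) p.1 ∂((densityLaw (heatEvolve s f)).prod (heatLaw (t - s))) = α := by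
  have := (hf.heatEvolve_regular s).isProbabilityMeasure
  rw [integral_fun_fst, integral_belowInd, (hf.heatEvolve_regular s).measureReal_densityLaw
    measurableSet_Iic, hq s hs]
  simp

lemma integral_comp_add_eq (hf : RegularDensity f C) {s t : ℝ} (hs : 0 ≤ s) (hst : s ≤ t)
    {h : ℝ → ℝ} (hh : Measurable h) :
    ∫ p, h (p.1 + p.2) ∂((densityLaw (heatEvolve s f)).prod (heatLaw (t - s)))
      = ∫ x, h x ∂(densityLaw (heatEvolve t f)) := by
  rw [densityLaw_heatEvolve_eq_conv hf hs hst, Measure.conv,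
    integral_map (by fun_prop) hh.aestronglyMeasurable]

lemma integral_belowInd_add_eq (hf : RegularDensity f C)
    (hq : ∀ t, 0 ≤ t → ∫ x in Iic (q t), heatEvolve t f x = α) {s t : ℝ} (hs : 0 ≤ s)
    (hst : s ≤ t) :
    ∫ p, belowInd (q t) (p.1 + p.2)
      ∂((densityLaw (heatEvolve s f)).prod (heatLaw (t - s))) = α := by
  rw [integral_comp_add_eq hf hs hst (measurable_belowInd _), integral_belowInd,
    (hf.heatEvolve_regular t).measureReal_densityLaw measurableSet_Iic, hq t (hs.trans hst)]

lemma integral_abs_belowInd_sub (hf : RegularDensity f C)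
    (hq : ∀ t, 0 ≤ t → ∫ x in Iic (q t), heatEvolve t f x = α) {s t : ℝ} (hs : 0 ≤ s)
    (hst : s ≤ t) :
    ∫ p, |belowInd (q t) (p.1 + p.2) - belowInd (q s) p.1|
      ∂((densityLaw (heatEvolve s f)).prod (heatLaw (t - s))) = 2 * (α - coProb f q s t) := by
  have := (hf.heatEvolve_regular s).isProbabilityMeasure
  have h : ∀ p : ℝ × ℝ, |belowInd (q t) (p.1 + p.2) - belowInd (q s) p.1|
      = belowInd (q t) (p.1 + p.2) + belowInd (q s) p.1
        - 2 * (belowInd (q s) p.1 * belowInd (q t) (p.1 + p.2)) := fun p => by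
    unfold belowInd; split_ifs <;> norm_num
  have i1 : Integrable (fun p : ℝ × ℝ => belowInd (q t) (p.1 + p.2))
      ((densityLaw (heatEvolve s f)).prod (heatLaw (t - s))) :=
    Integrable.of_bound (C := 1) (Measurable.aestronglyMeasurable (by fun_prop))
      (ae_of_all _ fun p => norm_belowInd_le _ _)
  have i2 : Integrable (fun p : ℝ × ℝ => belowInd (q s) p.1)
      ((densityLaw (heatEvolve s f)).prod (heatLaw (t - s))) :=
    Integrable.of_bound (C := 1) (Measurable.aestronglyMeasurable (by fun_prop))
      (ae_of_all _ fun p => norm_belowInd_le _ _)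
  have i3 : Integrable (fun p : ℝ × ℝ => belowInd (q s) p.1 * belowInd (q t) (p.1 + p.2))
      ((densityLaw (heatEvolve s f)).prod (heatLaw (t - s))) :=
    i1.bdd_mul (c := 1) (Measurable.aestronglyMeasurable (by fun_prop))
      (ae_of_all _ fun p => norm_belowInd_le _ _)
  simp_rw [h]
  rw [integral_sub (f := fun p : ℝ × ℝ => belowInd (q t) (p.1 + p.2) + belowInd (q s) p.1)
    (i1.add i2) (i3.const_mul 2), integral_add i1 i2, integral_const_mul,
    integral_belowInd_fst hf hq hs, integral_belowInd_add_eq hf hq hs hst, coProb]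
  ring

lemma coProb_self (hf : RegularDensity f C)
    (hq : ∀ t, 0 ≤ t → ∫ x in Iic (q t), heatEvolve t f x = α) {t : ℝ} (ht : 0 ≤ t) :
    coProb f q t t = α := by
  rw [← integral_belowInd_fst hf hq ht t, coProb]
  have := (hf.heatEvolve_regular t).isProbabilityMeasure
  rw [sub_self, heatLaw_zero, integral_prod, integral_prod]
  · simp only [integral_dirac, add_zero]
    refine integral_congr_ae (ae_of_all _ fun x => ?_)
    simp only [belowInd]; split_ifs <;> norm_num
  · exact Integrable.of_bound (C := 1) (Measurable.aestronglyMeasurable (by fun_prop))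
      (ae_of_all _ fun p => norm_belowInd_le _ _)
  · refine Integrable.of_bound (C := 1) (Measurable.aestronglyMeasurable (by fun_prop))
      (ae_of_all _ fun p => ?_)
    rw [norm_mul]
    exact mul_le_one₀ (norm_belowInd_le _ _) (norm_nonneg _) (norm_belowInd_le _ _)

/-- The probability of crossing the quantile between the times `s` and `t`, up to an error of
order `t - s`. -/
lemma abs_sub_coProb_sub_le (hf : RegularDensity f C)
    (hq : ∀ t, 0 ≤ t → ∫ x in Iic (q t), heatEvolve t f x = α) {K s t : ℝ} (hs : 0 ≤ s)
    (hst : s ≤ t) (hK : |q t - q s| ≤ K * |t - s|) :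
    |α - coProb f q s t - heatEvolve s f (q s) * (√(2 / π) * √(t - s) / 2)|
      ≤ (C * K + 2 * C) * (t - s) + 2 * C * (K * (t - s)) ^ 2 := by
  have hg := hf.heatEvolve_regular s
  have := hg.isProbabilityMeasure
  have hC := hf.const_nonneg
  have hts : 0 ≤ t - s := sub_nonneg.2 hst
  rw [abs_of_nonneg hts] at hK
  set g := heatEvolve s f with hgdef
  set μ := densityLaw g
  set γ := heatLaw (t - s)
  have i1 : Integrable (fun p : ℝ × ℝ => belowInd (q s) p.1) (μ.prod γ) :=
    Integrable.of_bound (C := 1) (Measurable.aestronglyMeasurable (by fun_prop))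
      (ae_of_all _ fun p => norm_belowInd_le _ _)
  have i3 : Integrable (fun p : ℝ × ℝ => belowInd (q s) p.1 * belowInd (q t) (p.1 + p.2))
      (μ.prod γ) :=
    i1.mul_bdd (c := 1) (Measurable.aestronglyMeasurable (by fun_prop))
      (ae_of_all _ fun p => norm_belowInd_le _ _)
  set φ : ℝ → ℝ := fun z =>
    ∫ x, (belowInd (q s) x - belowInd (q s) x * belowInd (q t) (x + z)) ∂μ with hφ
  have e1 : α - coProb f q s t = ∫ z, φ z ∂γ := by
    rw [← integral_belowInd_fst hf hq hs t, coProb, ← integral_sub i1 i3, integral_prod_symm]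
    exact i1.sub i3
  have hφi : Integrable φ γ := (i1.sub i3).integral_prod_right
  have e2 : ∀ z, φ z = if q t - q s ≤ z then ∫ x in (q t - z)..(q s), g x else 0 := by
    intro z
    split_ifs with hz
    · rw [intervalIntegral.integral_of_le (by linarith), ← hg.measureReal_densityLaw
        measurableSet_Ioc, ← integral_indicator_one measurableSet_Ioc]
      refine integral_congr_ae (ae_of_all _ fun x => ?_)
      simp only [belowInd, indicator, mem_Ioc, Pi.one_apply]
      by_cases h1 : x ≤ q s <;> by_cases h2 : x + z ≤ q t
      · rw [if_pos h1, if_pos h2, if_neg (by intro h; linarith [h.1])]; norm_num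
      · rw [if_pos h1, if_neg h2, if_pos ⟨by linarith, h1⟩]; norm_num
      · simp [h1]
      · simp [h1]
    · rw [hφ, ← integral_zero ℝ ℝ (μ := μ)]
      refine integral_congr_ae (ae_of_all _ fun x => ?_)
      simp only [belowInd]
      by_cases h1 : x ≤ q s
      · rw [if_pos h1, if_pos (by linarith)]; norm_num
      · rw [if_neg h1]; norm_num
  have e3 : ∀ z, |φ z - g (q s) * max z 0|
      ≤ C * |q t - q s| + C * (2 * z ^ 2 + 2 * |q t - q s| ^ 2) := by
    intro z
    set d := q t - q s
    have hgs := hg.nonneg (q s)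
    have hgC := hg.le (q s)
    have hmax : |max (z - d) 0 - max z 0| ≤ |d| := by
      refine (abs_max_sub_max_le_abs _ _ _).trans ?_
      rw [show z - d - z = -d by ring, abs_neg]
    have hmain : |φ z - g (q s) * max (z - d) 0| ≤ C * (z - d) ^ 2 := by
      rw [e2]
      split_ifs with hz
      · rw [max_eq_left (by linarith), intervalIntegral.integral_symm]
        have := hg.abs_intervalIntegral_sub_le (q s) (q t - z)
        rw [← abs_neg, show q t - z - q s = -(z - d) by simp only [d]; ring] at this
        convert this using 1
        · congr 1; ring
        · ring
      · rw [max_eq_right (by linarith)]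
        simp; positivity
    calc |φ z - g (q s) * max z 0|
        = |(φ z - g (q s) * max (z - d) 0) + g (q s) * (max (z - d) 0 - max z 0)| := by ring_nf
      _ ≤ C * (z - d) ^ 2 + C * |d| := by
          refine (abs_add_le _ _).trans (add_le_add hmain ?_)
          rw [abs_mul, abs_of_nonneg hgs]
          exact mul_le_mul hgC hmax (abs_nonneg _) hC
      _ ≤ _ := by
          rw [sq_abs]
          nlinarith [mul_nonneg hC (sq_nonneg (z + d))]
  have imax : Integrable (fun z : ℝ => g (q s) * max z 0) γ :=
    ((integrable_id_heatLaw _).sup (integrable_const 0)).const_mul _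
  have e4 : ∫ z, (φ z - g (q s) * max z 0) ∂γ
      = α - coProb f q s t - g (q s) * (√(2 / π) * √(t - s) / 2) := by
    rw [integral_sub hφi imax, ← e1, integral_const_mul, integral_posPart_heatLaw hts]
  rw [← e4, ← Real.norm_eq_abs]
  have isq := (integrable_pow_heatLaw (t - s) 2).const_mul 2
  refine (norm_integral_le_of_norm_le
    (g := fun z => C * |q t - q s| + C * (2 * z ^ 2 + 2 * |q t - q s| ^ 2))
    ((integrable_const _).add ((isq.add (integrable_const _)).const_mul C))
    (ae_of_all _ fun z => (Real.norm_eq_abs _).trans_le (e3 z))).trans ?_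
  rw [integral_add (g := fun z => C * (2 * z ^ 2 + 2 * |q t - q s| ^ 2)) (integrable_const _)
      ((isq.add (integrable_const _)).const_mul C),
    integral_const_mul C (fun z : ℝ => 2 * z ^ 2 + 2 * |q t - q s| ^ 2),
    integral_add isq (integrable_const _), integral_const_mul 2 (fun z : ℝ => z ^ 2),
    integral_sq_heatLaw hts]
  simp only [integral_const, probReal_univ, one_smul]
  have hd0 := abs_nonneg (q t - q s)
  have h1 : |q t - q s| ^ 2 ≤ (K * (t - s)) ^ 2 := pow_le_pow_left₀ hd0 hK 2
  nlinarith [mul_le_mul_of_nonneg_left hK hC, mul_le_mul_of_nonneg_left h1 hC]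

end

section

variable {f q : ℝ → ℝ} {α C : ℝ}

/-- The probability that a Brownian motion at `y` at time `t` lies below `q r` at time `r`. -/
noncomputable def transBelow (q : ℝ → ℝ) (t r y : ℝ) : ℝ := (heatLaw (r - t)).real (Iic (q r - y))

@[fun_prop]
lemma measurable_transBelow (q : ℝ → ℝ) (t r : ℝ) : Measurable (transBelow q t r) := by
  refine Antitone.measurable fun x y hxy => ?_
  exact measureReal_mono (Iic_subset_Iic.2 (by linarith))

lemma norm_transBelow_le (q : ℝ → ℝ) (t r y : ℝ) : ‖transBelow q t r y‖ ≤ 1 := by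
  rw [Real.norm_eq_abs, abs_of_nonneg (by exact measureReal_nonneg)]
  exact measureReal_le_one

lemma integral_transBelow_add {s t r : ℝ} (hst : s ≤ t) (htr : t ≤ r) (q : ℝ → ℝ) (x : ℝ) :
    ∫ z, transBelow q t r (x + z) ∂(heatLaw (t - s)) = (heatLaw (r - s)).real (Iic (q r - x)) := by
  have e : heatLaw (r - s) = (heatLaw (t - s)).conv (heatLaw (r - t)) := by
    rw [heatLaw_conv (sub_nonneg.2 hst) (sub_nonneg.2 htr)]
    congr 1; ring
  rw [← integral_belowInd_add, e, Measure.conv, integral_map (by fun_prop)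
    (Measurable.aestronglyMeasurable (by fun_prop)), integral_prod]
  · refine integral_congr_ae (ae_of_all _ fun z => ?_)
    simp only [transBelow, ← integral_belowInd_add, add_assoc]
  · exact Integrable.of_bound (C := 1) (Measurable.aestronglyMeasurable (by fun_prop))
      (ae_of_all _ fun p => norm_belowInd_le _ _)

lemma coProb_eq_integral_transBelow (hf : RegularDensity f C) {s r : ℝ} :
    coProb f q s r
      = ∫ x, belowInd (q s) x * transBelow q s r x ∂(densityLaw (heatEvolve s f)) := by
  have := (hf.heatEvolve_regular s).isProbabilityMeasure
  rw [coProb, integral_prod]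
  · refine integral_congr_ae (ae_of_all _ fun x => ?_)
    simp only [transBelow]
    rw [integral_const_mul, integral_belowInd_add]
  · refine Integrable.of_bound (C := 1) (Measurable.aestronglyMeasurable (by fun_prop))
      (ae_of_all _ fun p => ?_)
    rw [norm_mul]
    exact mul_le_one₀ (norm_belowInd_le _ _) (norm_nonneg _) (norm_belowInd_le _ _)

lemma coProb_eq_integral_fst (hf : RegularDensity f C) {s t r : ℝ} (hst : s ≤ t) (htr : t ≤ r) :
    coProb f q s r = ∫ p, belowInd (q s) p.1 * transBelow q t r (p.1 + p.2)
      ∂((densityLaw (heatEvolve s f)).prod (heatLaw (t - s))) := by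
  have := (hf.heatEvolve_regular s).isProbabilityMeasure
  rw [coProb_eq_integral_transBelow hf, integral_prod]
  · refine integral_congr_ae (ae_of_all _ fun x => ?_)
    simp only
    rw [integral_const_mul, integral_transBelow_add hst htr, transBelow]
  · refine Integrable.of_bound (C := 1) (Measurable.aestronglyMeasurable (by fun_prop))
      (ae_of_all _ fun p => ?_)
    rw [norm_mul]
    exact mul_le_one₀ (norm_belowInd_le _ _) (norm_nonneg _) (norm_transBelow_le _ _ _ _)

lemma coProb_eq_integral_add (hf : RegularDensity f C) {s t r : ℝ} (hs : 0 ≤ s) (hst : s ≤ t) :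
    coProb f q t r = ∫ p, belowInd (q t) (p.1 + p.2) * transBelow q t r (p.1 + p.2)
      ∂((densityLaw (heatEvolve s f)).prod (heatLaw (t - s))) := by
  rw [coProb_eq_integral_transBelow hf, integral_comp_add_eq hf hs hst
    (h := fun x => belowInd (q t) x * transBelow q t r x) (by fun_prop)]

lemma heatLaw_Iic_sub_le {σ τ a b M : ℝ} (hσ : 0 < σ) (hστ : σ ≤ τ) (hM : 0 ≤ M)
    (hab : b - a ≤ M * (τ - σ)) (ha : -M * σ ≤ a) :
    (heatLaw τ).real (Iic b) - (heatLaw σ).real (Iic a) ≤ 3 * M * (√τ - √σ) := by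
  have hτ := hσ.trans_le hστ
  have h1 := sqrt_pos.2 hσ
  have h2 := sqrt_le_sqrt hστ
  have h3 := h1.trans_le h2
  have e1 := sq_sqrt hσ.le
  have e2 := sq_sqrt hτ.le
  rw [heatLaw_Iic hτ, heatLaw_Iic hσ]
  refine (heatLaw_one_Iic_sub_le _ _).trans (max_le ?_ ?_)
  · set x := √σ
    set y := √τ
    rw [← e1, ← e2] at hab
    rw [← e1] at ha
    have h4 : b / y - a / x = (b - a) / y + (-a) * ((y - x) / (x * y)) := by
      field_simp; ring
    rw [h4]
    have hyx := sub_nonneg.2 h2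
    have i1 : (b - a) / y ≤ 2 * M * (y - x) := by
      rw [div_le_iff₀ h3]
      refine hab.trans ?_
      nlinarith [mul_nonneg hM (mul_nonneg hyx hyx)]
    have i2 : (-a) * ((y - x) / (x * y)) ≤ M * x ^ 2 * ((y - x) / (x * y)) :=
      mul_le_mul_of_nonneg_right (by linarith) (by positivity)
    have i3 : M * x ^ 2 * ((y - x) / (x * y)) ≤ M * (y - x) := by
      rw [← mul_div_assoc, div_le_iff₀ (by positivity)]
      nlinarith [mul_nonneg (mul_nonneg hM hyx) (mul_nonneg h1.le hyx)]
    linarith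
  · have := sub_nonneg.2 h2
    positivity

lemma heatLaw_Iic_le_sub {σ τ a b M : ℝ} (hσ : 0 < σ) (hστ : σ ≤ τ) (hM : 0 ≤ M)
    (hab : a - b ≤ M * (τ - σ)) (ha : a ≤ M * σ) :
    (heatLaw σ).real (Iic a) - (heatLaw τ).real (Iic b) ≤ 3 * M * (√τ - √σ) := by
  have hτ := hσ.trans_le hστ
  have h1 := sqrt_pos.2 hσ
  have h2 := sqrt_le_sqrt hστ
  have h3 := h1.trans_le h2
  have e1 := sq_sqrt hσ.le
  have e2 := sq_sqrt hτ.le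
  rw [heatLaw_Iic hτ, heatLaw_Iic hσ]
  refine (heatLaw_one_Iic_sub_le _ _).trans (max_le ?_ ?_)
  · set x := √σ
    set y := √τ
    rw [← e1, ← e2] at hab
    rw [← e1] at ha
    have h4 : a / x - b / y = (a - b) / y + a * ((y - x) / (x * y)) := by
      field_simp; ring
    rw [h4]
    have hyx := sub_nonneg.2 h2
    have i1 : (a - b) / y ≤ 2 * M * (y - x) := by
      rw [div_le_iff₀ h3]
      refine hab.trans ?_
      nlinarith [mul_nonneg hM (mul_nonneg hyx hyx)]
    have i2 : a * ((y - x) / (x * y)) ≤ M * x ^ 2 * ((y - x) / (x * y)) :=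
      mul_le_mul_of_nonneg_right (by linarith) (by positivity)
    have i3 : M * x ^ 2 * ((y - x) / (x * y)) ≤ M * (y - x) := by
      rw [← mul_div_assoc, div_le_iff₀ (by positivity)]
      nlinarith [mul_nonneg (mul_nonneg hM hyx) (mul_nonneg h1.le hyx)]
    linarith
  · have := sub_nonneg.2 h2
    positivity

/-- A point below the quantile at time `t` becomes at most slightly more likely to lie below the
quantile as time evolves. -/
lemma transBelow_sub_le {K t s r y : ℝ} (hK : 0 ≤ K) (hts : t ≤ s) (hsr : s ≤ r)
    (h1 : |q s - q t| ≤ K * |s - t|) (h2 : |q r - q s| ≤ K * |r - s|) (hy : y ≤ q t) :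
    transBelow q t r y - transBelow q t s y ≤ 3 * K * (√(r - t) - √(s - t)) := by
  rw [abs_of_nonneg (sub_nonneg.2 hts)] at h1
  rw [abs_of_nonneg (sub_nonneg.2 hsr)] at h2
  have h1' := abs_le.1 h1
  have h2' := abs_le.1 h2
  rcases hts.eq_or_lt with rfl | hlt
  · have : transBelow q t t y = 1 := by
      simp [transBelow, heatLaw_zero, measureReal_def, hy]
    rw [this]
    have h3 : transBelow q t r y ≤ 1 := measureReal_le_one
    have : 0 ≤ 3 * K * (√(r - t) - √(t - t)) := by simp; positivity
    linarith
  · exact heatLaw_Iic_sub_le (by linarith) (by linarith) hK (by linarith [h2'.2]) (by linarith)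

lemma le_transBelow_sub {K t s r y : ℝ} (hK : 0 ≤ K) (hts : t ≤ s) (hsr : s ≤ r)
    (h1 : |q s - q t| ≤ K * |s - t|) (h2 : |q r - q s| ≤ K * |r - s|) (hy : q t < y) :
    transBelow q t s y - transBelow q t r y ≤ 3 * K * (√(r - t) - √(s - t)) := by
  rw [abs_of_nonneg (sub_nonneg.2 hts)] at h1
  rw [abs_of_nonneg (sub_nonneg.2 hsr)] at h2
  have h1' := abs_le.1 h1
  have h2' := abs_le.1 h2
  rcases hts.eq_or_lt with rfl | hlt
  · have : transBelow q t t y = 0 := by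
      simp [transBelow, heatLaw_zero, measureReal_def, hy]
    rw [this]
    have h3 : 0 ≤ transBelow q t r y := measureReal_nonneg
    have : 0 ≤ 3 * K * (√(r - t) - √(t - t)) := by simp; positivity
    linarith
  · exact heatLaw_Iic_le_sub (by linarith) (by linarith) hK (by linarith [h2'.2]) (by linarith)

/-- Increments over disjoint time intervals of the process of indicators of being below the
quantile are almost negatively correlated. -/
lemma coProb_increment_le (hf : RegularDensity f C)
    (hq : ∀ t, 0 ≤ t → ∫ x in Iic (q t), heatEvolve t f x = α) {K s t s' t' : ℝ} (hK : 0 ≤ K)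
    (hs : 0 ≤ s) (hst : s ≤ t) (hts' : t ≤ s') (hst' : s' ≤ t')
    (h1 : |q s' - q t| ≤ K * |s' - t|) (h2 : |q t' - q s'| ≤ K * |t' - s'|) :
    coProb f q t t' - coProb f q t s' - coProb f q s t' + coProb f q s s'
      ≤ 3 * K * (√(t' - t) - √(s' - t)) * (2 * (α - coProb f q s t)) := by
  have := (hf.heatEvolve_regular s).isProbabilityMeasure
  rw [← integral_abs_belowInd_sub hf hq hs hst, coProb_eq_integral_add hf hs hst,
    coProb_eq_integral_add hf hs hst, coProb_eq_integral_fst hf hst (hts'.trans hst'),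
    coProb_eq_integral_fst hf hst hts']
  set ν := (densityLaw (heatEvolve s f)).prod (heatLaw (t - s))
  have ia : ∀ r, Integrable (fun p : ℝ × ℝ =>
      belowInd (q t) (p.1 + p.2) * transBelow q t r (p.1 + p.2)) ν := fun r => by
    refine Integrable.of_bound (C := 1) (Measurable.aestronglyMeasurable (by fun_prop))
      (ae_of_all _ fun p => ?_)
    rw [norm_mul]
    exact mul_le_one₀ (norm_belowInd_le _ _) (norm_nonneg _) (norm_transBelow_le _ _ _ _)
  have ib : ∀ r, Integrable (fun p : ℝ × ℝ =>
      belowInd (q s) p.1 * transBelow q t r (p.1 + p.2)) ν := fun r => by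
    refine Integrable.of_bound (C := 1) (Measurable.aestronglyMeasurable (by fun_prop))
      (ae_of_all _ fun p => ?_)
    rw [norm_mul]
    exact mul_le_one₀ (norm_belowInd_le _ _) (norm_nonneg _) (norm_transBelow_le _ _ _ _)
  have ic : Integrable (fun p : ℝ × ℝ =>
      |belowInd (q t) (p.1 + p.2) - belowInd (q s) p.1|) ν := by
    refine Integrable.of_bound (C := 1) (Measurable.aestronglyMeasurable (by fun_prop))
      (ae_of_all _ fun p => ?_)
    unfold belowInd; split_ifs <;> norm_num
  rw [← integral_sub' (ia _) (ia _), ← integral_sub' ((ia _).sub (ia _)) (ib _),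
    ← integral_add' (((ia _).sub (ia _)).sub (ib _)) (ib _), ← integral_const_mul]
  refine integral_mono ((((ia _).sub (ia _)).sub (ib _)).add (ib _)) (ic.const_mul _) fun p => ?_
  set e := 3 * K * (√(t' - t) - √(s' - t))
  have e0 : 0 ≤ e := by
    have := sub_nonneg.2 (sqrt_le_sqrt (show s' - t ≤ t' - t by linarith))
    positivity
  simp only [Pi.sub_apply, Pi.add_apply]
  rcases le_or_gt (p.1 + p.2) (q t) with hy | hy
  · have h3 := transBelow_sub_le hK hts' hst' h1 h2 hy
    simp only [belowInd, if_pos hy]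
    split_ifs <;> norm_num <;> linarith
  · have h3 := le_transBelow_sub hK hts' hst' h1 h2 hy
    simp only [belowInd, if_neg (not_le.2 hy)]
    split_ifs <;> norm_num <;> linarith

end

/-- Estimates on the time interval `[0, T]` for the probabilities `M s t` that a process is below
its `α`-quantile at both of the times `s` and `t`, where `w` is the reciprocal of the density at
the quantile. -/
structure CrossingEstimates (M : ℝ → ℝ → ℝ) (w : ℝ → ℝ) (α A T : ℝ) : Prop where
  one_le : 1 ≤ A
  symm : ∀ s t, M s t = M t s
  self : ∀ t ∈ Icc 0 T, M t t = α
  bound : ∀ s ∈ Icc 0 T, ∀ t ∈ Icc 0 T, |M s t - α ^ 2| ≤ 1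
  incr : ∀ s ∈ Icc 0 T, ∀ t ∈ Icc 0 T, ∀ r ∈ Icc 0 T, |M t r - M s r| ≤ 2 * (α - M s t)
  small : ∀ s ∈ Icc 0 T, ∀ t ∈ Icc 0 T, s ≤ t → α - M s t ≤ A * √(t - s)
  near : ∀ s ∈ Icc 0 T, ∀ t ∈ Icc 0 T, s ≤ t →
    |w s * (α - M s t) - √(2 / π) * √(t - s) / 2| ≤ A * (t - s)
  far : ∀ s ∈ Icc 0 T, ∀ t ∈ Icc 0 T, ∀ s' ∈ Icc 0 T, ∀ t' ∈ Icc 0 T, s ≤ t → t ≤ s' → s' ≤ t' →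
    M t t' - M t s' - M s t' + M s s' ≤ A * (√(t' - t) - √(s' - t)) * (α - M s t)
  w_nonneg : ∀ t ∈ Icc 0 T, 0 ≤ w t
  w_le : ∀ t ∈ Icc 0 T, w t ≤ A
  w_lip : ∀ s ∈ Icc 0 T, ∀ t ∈ Icc 0 T, |w t - w s| ≤ A * |t - s|

section

variable {f q : ℝ → ℝ} {α C : ℝ}

lemma setIntegral_heatKernel {τ : ℝ} (hτ : 0 < τ) (x b : ℝ) :
    ∫ y in Iic b, heatKernel τ x y = (heatLaw τ).real (Iic (b - x)) := by
  have hv : τ.toNNReal ≠ 0 := by simpa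
  have h1 : ∀ y, heatKernel τ x y = gaussianPDFReal x τ.toNNReal y := fun y => by
    simp only [heatKernel, gaussianPDFReal, Real.coe_toNNReal _ hτ.le]
    congr 3
    ring
  have h2 := gaussianReal_apply_eq_integral x hv (Iic b)
  have h3 : gaussianReal x τ.toNNReal (Iic b) = heatLaw τ (Iic (b - x)) := by
    have h := gaussianReal_map_const_add (μ := 0) (v := τ.toNNReal) x
    rw [zero_add] at h
    rw [← h, Measure.map_apply (by fun_prop) measurableSet_Iic, heatLaw]
    congr 1
    ext z
    simp [le_sub_iff_add_le, add_comm]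
  simp_rw [h1]
  rw [measureReal_def, ← h3, h2, ENNReal.toReal_ofReal]
  exact integral_nonneg fun y => gaussianPDFReal_nonneg _ _ _

lemma coProb_eq_setIntegral (hf : RegularDensity f C) {s t : ℝ} (hs : 0 ≤ s) (hst : s < t) :
    coProb f q s t
      = ∫ x in Iic (q s), (∫ y in Iic (q t), heatKernel (t - s) x y) * udens f x s := by
  have hg := hf.heatEvolve_regular s
  rw [coProb_eq_integral_transBelow hf, densityLaw, integral_withDensity_eq_integral_toReal_smul
    hg.continuous.measurable.ennreal_ofReal (ae_of_all _ fun x => ENNReal.ofReal_lt_top),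
    ← integral_indicator measurableSet_Iic]
  refine integral_congr_ae (ae_of_all _ fun x => ?_)
  simp only [ENNReal.toReal_ofReal (hg.nonneg x), smul_eq_mul, belowInd, indicator,
    mem_Iic, setIntegral_heatKernel (sub_pos.2 hst), udens_eq_heatEvolve f hs, transBelow]
  split_ifs <;> ring

lemma abs_measureReal_inter_sub_le {Ω : Type*} [MeasurableSpace Ω] (P : Measure Ω)
    [IsProbabilityMeasure P] {D E A : Set Ω} (hD : MeasurableSet D) (hE : MeasurableSet E) :
    |P.real (E ∩ A) - P.real (D ∩ A)| ≤ P.real D + P.real E - 2 * P.real (D ∩ E) := by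
  have h1 := measureReal_inter_add_sdiff (μ := P) (s := E ∩ A) hD
  have h2 := measureReal_inter_add_sdiff (μ := P) (s := D ∩ A) hE
  have h3 := measureReal_inter_add_sdiff (μ := P) (s := E) hD
  have h4 := measureReal_inter_add_sdiff (μ := P) (s := D) hE
  have e : E ∩ A ∩ D = D ∩ A ∩ E := by ext; simp; tauto
  rw [e] at h1
  rw [inter_comm E D] at h3
  have h5 : P.real ((E ∩ A) \ D) ≤ P.real (E \ D) :=
    measureReal_mono (sdiff_subset_sdiff_left inter_subset_left)
  have h6 : P.real ((D ∩ A) \ E) ≤ P.real (D \ E) :=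
    measureReal_mono (sdiff_subset_sdiff_left inter_subset_left)
  have h7 : 0 ≤ P.real ((E ∩ A) \ D) := measureReal_nonneg
  have h8 : 0 ≤ P.real ((D ∩ A) \ E) := measureReal_nonneg
  rw [abs_le]
  constructor <;> linarith

lemma exists_crossingEstimates (hf : RegularDensity f C)
    (hq : ∀ t, 0 ≤ t → ∫ x in Iic (q t), heatEvolve t f x = α)
    (hpos : ∀ t, 0 ≤ t → 0 < heatEvolve t f (q t)) {T : ℝ} (hT : 0 < T)
    {Ω : Type*} [MeasurableSpace Ω] (P : Measure Ω) [IsProbabilityMeasure P] {E : ℝ → Set Ω}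
    (hE : ∀ t, MeasurableSet (E t))
    (hP : ∀ s t, 0 ≤ s → s ≤ t → P.real (E s ∩ E t) = coProb f q s t) :
    ∃ A, CrossingEstimates (fun s t => P.real (E s ∩ E t)) (fun t => (heatEvolve t f (q t))⁻¹)
      α A T := by
  obtain ⟨K, hK, hb⟩ := exists_quantile_bounds hf hq hpos hT
  have hPE : ∀ t, 0 ≤ t → P.real (E t) = α := fun t ht => by
    rw [← coProb_self hf hq ht, ← hP t t ht le_rfl, inter_self]
  have hC := hf.const_nonneg
  set D := (C * K + 2 * C) + 2 * C * K ^ 2 * T with hD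
  have hD0 : 0 ≤ D := by positivity
  have hnear : ∀ s ∈ Icc 0 T, ∀ t ∈ Icc 0 T, s ≤ t →
      |α - coProb f q s t - heatEvolve s f (q s) * (√(2 / π) * √(t - s) / 2)| ≤ D * (t - s) := by
    intro s hs t ht hst
    refine (abs_sub_coProb_sub_le hf hq hs.1 hst (hb s hs t ht).1).trans ?_
    have h1 : (t - s) * (t - s) ≤ T * (t - s) :=
      mul_le_mul_of_nonneg_right (by linarith [hs.1, ht.2]) (sub_nonneg.2 hst)
    have h2 := mul_le_mul_of_nonneg_left h1 (show 0 ≤ 2 * C * K ^ 2 by positivity)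
    rw [hD]
    linarith
  have hπ : √(2 / π) ≤ 1 := sqrt_le_one.2 ((div_le_one pi_pos).2 two_le_pi)
  set A := 1 + K + 6 * K + D * K + (C + D * √T) with hA
  have hT0 := sqrt_nonneg T
  have a1 : 0 ≤ D * K := by positivity
  have a2 : 0 ≤ D * √T := by positivity
  refine ⟨A, by linarith, fun s t => by simp only [inter_comm], fun t ht => ?_, ?_, ?_, ?_, ?_, ?_,
    fun t ht => (inv_pos.2 (hpos t ht.1)).le, fun t ht => (hb t ht t ht).2.1.trans (by linarith),
    fun s hs t ht => (hb s hs t ht).2.2.trans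
      (mul_le_mul_of_nonneg_right (by linarith) (abs_nonneg _))⟩
  · simp [hPE t ht.1]
  · intro s hs t ht
    have h1 : 0 ≤ P.real (E s ∩ E t) := measureReal_nonneg
    have h2 : P.real (E s ∩ E t) ≤ 1 := measureReal_le_one
    have h3 : 0 ≤ α := by rw [← hPE s hs.1]; exact measureReal_nonneg
    have h4 : α ≤ 1 := by rw [← hPE s hs.1]; exact measureReal_le_one
    rw [abs_le]
    constructor <;> nlinarith
  · intro s hs t ht r hr
    have := abs_measureReal_inter_sub_le P (A := E r) (hE s) (hE t)
    rw [hPE s hs.1, hPE t ht.1] at this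
    linarith
  · intro s hs t ht hst
    rw [hP s t hs.1 hst]
    have h1 := (abs_le.1 (hnear s hs t ht hst)).2
    have h0 := sqrt_nonneg (t - s)
    have h2 : heatEvolve s f (q s) * (√(2 / π) * √(t - s) / 2) ≤ C * √(t - s) := by
      refine mul_le_mul ((hf.heatEvolve_regular s).le _) ?_ (by positivity) hC
      nlinarith [mul_le_mul_of_nonneg_right hπ h0]
    have h3 : t - s ≤ √T * √(t - s) := by
      nth_rewrite 1 [← mul_self_sqrt (sub_nonneg.2 hst)]
      exact mul_le_mul_of_nonneg_right (sqrt_le_sqrt (by linarith [hs.1, ht.2])) h0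
    have h4 := mul_le_mul_of_nonneg_left h3 hD0
    have h5 : (C + D * √T) * √(t - s) ≤ A * √(t - s) :=
      mul_le_mul_of_nonneg_right (by linarith) h0
    linarith
  · intro s hs t ht hst
    rw [hP s t hs.1 hst]
    have h1 := hnear s hs t ht hst
    have h2 : (heatEvolve s f (q s))⁻¹ * (α - coProb f q s t) - √(2 / π) * √(t - s) / 2
        = (heatEvolve s f (q s))⁻¹
          * (α - coProb f q s t - heatEvolve s f (q s) * (√(2 / π) * √(t - s) / 2)) := by
      have := (hpos s hs.1).ne'
      field_simp
    rw [h2, abs_mul, abs_of_pos (inv_pos.2 (hpos s hs.1))]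
    refine (mul_le_mul (hb s hs s hs).2.1 h1 (abs_nonneg _) hK.le).trans ?_
    rw [← mul_assoc]
    exact mul_le_mul_of_nonneg_right (by linarith) (sub_nonneg.2 hst)
  · intro s hs t ht s' hs' t' ht' hst hts' hst'
    rw [hP _ _ ht.1 (hts'.trans hst'), hP _ _ ht.1 hts', hP _ _ hs.1 (hst.trans (hts'.trans hst')),
      hP _ _ hs.1 (hst.trans hts'), hP _ _ hs.1 hst]
    refine (coProb_increment_le hf hq hK.le hs.1 hst hts' hst' (hb t ht s' hs').1
      (hb s' hs' t' ht').1).trans ?_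
    have h1 : 0 ≤ √(t' - t) - √(s' - t) := sub_nonneg.2 (sqrt_le_sqrt (by linarith))
    have h2 : 0 ≤ α - coProb f q s t := by
      rw [← hP s t hs.1 hst, ← hPE s hs.1]
      exact sub_nonneg.2 (measureReal_mono inter_subset_left)
    have := mul_nonneg h1 h2
    nlinarith

/-- The covariance function is a positive semidefinite form. -/
lemma sum_sum_cov_nonneg {Ω : Type*} [MeasurableSpace Ω] (P : Measure Ω) [IsProbabilityMeasure P]
    {E : ℝ → Set Ω} (hE : ∀ t, MeasurableSet (E t)) {ι : Type*} [Fintype ι] (ts : ι → ℝ)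
    (hα : ∀ i, P.real (E (ts i)) = α) (c : ι → ℝ) :
    0 ≤ ∑ i, ∑ j, c i * c j * (P.real (E (ts i) ∩ E (ts j)) - α ^ 2) := by
  set Y : ι → Ω → ℝ := fun i => (E (ts i)).indicator 1 with hY
  have iY : ∀ i, Integrable (Y i) P := fun i => (integrable_const (1 : ℝ)).indicator (hE _)
  have eY : ∀ i, ∫ ω, Y i ω ∂P = α := fun i => by
    rw [← hα i, ← integral_indicator_one (hE _)]
  have e1 : ∀ i j, (fun ω => (Y i ω - α) * (Y j ω - α)) =
      (E (ts i) ∩ E (ts j)).indicator 1 - (fun ω => α * Y i ω) - (fun ω => α * Y j ω)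
        + fun _ => α ^ 2 := fun i j => by
    ext ω
    by_cases h1 : ω ∈ E (ts i) <;> by_cases h2 : ω ∈ E (ts j) <;> simp [hY, h1, h2] <;> ring
  have iI : ∀ i j, Integrable ((E (ts i) ∩ E (ts j)).indicator (1 : Ω → ℝ)) P := fun i j =>
    (integrable_const (1 : ℝ)).indicator ((hE _).inter (hE _))
  have i2 : ∀ i j, Integrable (fun ω => (Y i ω - α) * (Y j ω - α)) P := fun i j => by
    rw [e1]
    exact (((iI i j).sub ((iY i).const_mul α)).sub ((iY j).const_mul α)).add (integrable_const _)
  have e2 : ∀ i j, ∫ ω, (Y i ω - α) * (Y j ω - α) ∂P = P.real (E (ts i) ∩ E (ts j)) - α ^ 2 := by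
    intro i j
    rw [e1, integral_add' (((iI i j).sub ((iY i).const_mul α)).sub ((iY j).const_mul α))
      (integrable_const _), integral_sub' ((iI i j).sub ((iY i).const_mul α)) ((iY j).const_mul α),
      integral_sub' (iI i j) ((iY i).const_mul α), integral_const_mul, integral_const_mul, eY, eY,
      integral_indicator_one ((hE _).inter (hE _))]
    simp
    ring
  have e3 : ∑ i, ∑ j, c i * c j * (P.real (E (ts i) ∩ E (ts j)) - α ^ 2)
      = ∫ ω, (∑ i, c i * (Y i ω - α)) ^ 2 ∂P := by
    have : ∀ ω, (∑ i, c i * (Y i ω - α)) ^ 2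
        = ∑ i, ∑ j, c i * c j * ((Y i ω - α) * (Y j ω - α)) := fun ω => by
      rw [sq, Finset.sum_mul_sum]
      exact Finset.sum_congr rfl fun i _ => Finset.sum_congr rfl fun j _ => by ring
    simp_rw [this]
    rw [integral_finsetSum _ fun i _ => integrable_finsetSum _ fun j _ => (i2 i j).const_mul _]
    refine Finset.sum_congr rfl fun i _ => ?_
    rw [integral_finsetSum _ fun j _ => (i2 i j).const_mul _]
    refine Finset.sum_congr rfl fun j _ => ?_
    rw [integral_const_mul, e2]
  rw [e3]
  exact integral_nonneg fun ω => sq_nonneg _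

end

/-- The covariance of the increments over `[s, t]` and `[s', t']` of a process with covariance
`R`. -/
def incCov (R : ℝ → ℝ → ℝ) (s t s' t' : ℝ) : ℝ := R t t' - R t s' - R s t' + R s s'

namespace CrossingEstimates

variable {M : ℝ → ℝ → ℝ} {w : ℝ → ℝ} {α A T : ℝ}

lemma pos (h : CrossingEstimates M w α A T) : 0 < A := one_pos.trans_le h.one_le

lemma crossing_nonneg (h : CrossingEstimates M w α A T) {s t : ℝ} (hs : s ∈ Icc 0 T)
    (ht : t ∈ Icc 0 T) : 0 ≤ α - M s t := by
  linarith [abs_nonneg (M t s - M s s), h.incr s hs t ht s hs]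

lemma abs_incCov_self_sub_le (h : CrossingEstimates M w α A T) {s t : ℝ} (hs : s ∈ Icc 0 T)
    (ht : t ∈ Icc 0 T) (hst : s ≤ t) :
    |incCov (fun s t => w s * w t * (M s t - α ^ 2)) s t s t - √(2 / π) * w s * √(t - s)|
      ≤ (A ^ 2 * (T + 2) + A * √T) * (t - s) := by
  have hA := h.pos
  have hts : 0 ≤ t - s := by linarith
  have htT : t - s ≤ T := by linarith [hs.1, ht.2]
  have e : incCov (fun s t => w s * w t * (M s t - α ^ 2)) s t s t - √(2 / π) * w s * √(t - s)
      = (M t t - α ^ 2) * (w t - w s) ^ 2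
        + 2 * w t * (w s * (α - M s t) - √(2 / π) * √(t - s) / 2)
        + (w t - w s) * (√(2 / π) * √(t - s)) := by
    simp only [incCov]
    rw [h.symm t s, h.self t ht, h.self s hs]
    ring
  have hπ : √(2 / π) ≤ 1 := sqrt_le_one.2 ((div_le_one pi_pos).2 two_le_pi)
  have hw : |w t - w s| ≤ A * (t - s) := by
    simpa [abs_of_nonneg hts] using h.w_lip s hs t ht
  have b1 : |(M t t - α ^ 2) * (w t - w s) ^ 2| ≤ A ^ 2 * T * (t - s) := by
    rw [abs_mul, abs_pow]
    calc |M t t - α ^ 2| * |w t - w s| ^ 2 ≤ 1 * (A * (t - s)) ^ 2 :=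
          mul_le_mul (h.bound t ht t ht) (pow_le_pow_left₀ (abs_nonneg _) hw 2) (by positivity)
            zero_le_one
      _ = A ^ 2 * ((t - s) * (t - s)) := by ring
      _ ≤ A ^ 2 * (T * (t - s)) := by gcongr
      _ = _ := by ring
  have b2 : |2 * w t * (w s * (α - M s t) - √(2 / π) * √(t - s) / 2)| ≤ 2 * A * (A * (t - s)) := by
    rw [abs_mul, abs_of_nonneg (mul_nonneg zero_le_two (h.w_nonneg t ht))]
    exact mul_le_mul (by linarith [h.w_le t ht]) (h.near s hs t ht hst) (abs_nonneg _)
      (by positivity)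
  have b3 : |(w t - w s) * (√(2 / π) * √(t - s))| ≤ A * (t - s) * (1 * √T) := by
    rw [abs_mul, abs_of_nonneg (by positivity : 0 ≤ √(2 / π) * √(t - s))]
    exact mul_le_mul hw (mul_le_mul hπ (sqrt_le_sqrt htT) (sqrt_nonneg _) zero_le_one)
      (by positivity) (by positivity)
  rw [e]
  refine (abs_add_three _ _ _).trans ?_
  linarith

lemma abs_incCov_self_le (h : CrossingEstimates M w α A T) {s t : ℝ} (hs : s ∈ Icc 0 T)
    (ht : t ∈ Icc 0 T) (hst : s ≤ t) :
    |incCov (fun s t => w s * w t * (M s t - α ^ 2)) s t s t|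
      ≤ (A + (A ^ 2 * (T + 2) + A * √T) * √T) * √(t - s) := by
  have hA := h.pos
  have hT : 0 ≤ T := hs.1.trans hs.2
  have hts : 0 ≤ t - s := by linarith
  have htT : t - s ≤ T := by linarith [hs.1, ht.2]
  have hπ : √(2 / π) ≤ 1 := sqrt_le_one.2 ((div_le_one pi_pos).2 two_le_pi)
  have b1 := h.abs_incCov_self_sub_le hs ht hst
  have b2 : |√(2 / π) * w s * √(t - s)| ≤ 1 * A * √(t - s) := by
    rw [abs_of_nonneg (mul_nonneg (mul_nonneg (sqrt_nonneg _) (h.w_nonneg s hs)) (sqrt_nonneg _))]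
    exact mul_le_mul_of_nonneg_right
      (mul_le_mul hπ (h.w_le s hs) (h.w_nonneg s hs) zero_le_one) (sqrt_nonneg _)
  have b3 : (A ^ 2 * (T + 2) + A * √T) * (t - s)
      ≤ (A ^ 2 * (T + 2) + A * √T) * (√T * √(t - s)) := by
    refine mul_le_mul_of_nonneg_left ?_ (by positivity)
    nth_rewrite 1 [← mul_self_sqrt hts]
    exact mul_le_mul_of_nonneg_right (sqrt_le_sqrt htT) (sqrt_nonneg _)
  have := abs_sub_abs_le_abs_sub (incCov (fun s t => w s * w t * (M s t - α ^ 2)) s t s t)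
    (√(2 / π) * w s * √(t - s))
  linarith

lemma continuousOn_w (h : CrossingEstimates M w α A T) : ContinuousOn w (Icc 0 T) := by
  have : LipschitzOnWith A.toNNReal w (Icc 0 T) :=
    LipschitzOnWith.of_dist_le_mul fun x hx y hy => by
      rw [Real.coe_toNNReal _ h.pos.le, Real.dist_eq, Real.dist_eq]
      exact h.w_lip y hy x hx
  exact this.continuousOn

lemma intervalIntegrable_w_sq (h : CrossingEstimates M w α A T) {s t : ℝ} (hs : s ∈ Icc 0 T)
    (ht : t ∈ Icc 0 T) : IntervalIntegrable (fun r => w r ^ 2) volume s t :=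
  ((h.continuousOn_w.mono (uIcc_subset_Icc hs ht)).pow 2).intervalIntegrable

lemma abs_integral_w_sq_sub_le (h : CrossingEstimates M w α A T) {s t : ℝ} (hs : s ∈ Icc 0 T)
    (ht : t ∈ Icc 0 T) (hst : s ≤ t) :
    |(∫ r in s..t, w r ^ 2) - w s ^ 2 * (t - s)| ≤ 2 * A ^ 2 * (t - s) * (t - s) := by
  have hA := h.pos
  have e : (∫ r in s..t, w r ^ 2) - w s ^ 2 * (t - s) = ∫ r in s..t, (w r ^ 2 - w s ^ 2) := by
    rw [intervalIntegral.integral_sub (h.intervalIntegrable_w_sq hs ht) (by simp)]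
    simp [mul_comm]
  rw [e]
  have := intervalIntegral.norm_integral_le_of_norm_le_const (a := s) (b := t)
    (f := fun r => w r ^ 2 - w s ^ 2) (C := 2 * A ^ 2 * (t - s)) fun r hr => by
      rw [uIoc_of_le hst] at hr
      have hrT : r ∈ Icc 0 T := ⟨hs.1.trans hr.1.le, hr.2.trans ht.2⟩
      have h1 := h.w_lip s hs r hrT
      rw [abs_of_nonneg (a := r - s) (by linarith [hr.1])] at h1
      rw [sq_sub_sq, Real.norm_eq_abs, abs_mul,
        abs_of_nonneg (add_nonneg (h.w_nonneg r hrT) (h.w_nonneg s hs))]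
      calc (w r + w s) * |w r - w s| ≤ (2 * A) * (A * (t - s)) :=
            mul_le_mul (by linarith [h.w_le r hrT, h.w_le s hs])
              (h1.trans (mul_le_mul_of_nonneg_left (by linarith [hr.2]) hA.le)) (abs_nonneg _)
              (by linarith)
        _ = _ := by ring
  rwa [Real.norm_eq_abs, abs_of_nonneg (by linarith : 0 ≤ t - s)] at this

/-- The variance of an increment over a short interval determines the quartic variation. -/
lemma exists_abs_three_mul_incCov_sq_sub_le (h : CrossingEstimates M w α A T) :
    ∃ B, 0 ≤ B ∧ ∀ s ∈ Icc 0 T, ∀ t ∈ Icc 0 T, s ≤ t →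
      |3 * incCov (fun s t => w s * w t * (M s t - α ^ 2)) s t s t ^ 2
        - 6 / π * ∫ r in s..t, w r ^ 2| ≤ B * ((t - s) * √(t - s)) := by
  have hA := h.pos
  set D := A ^ 2 * (T + 2) + A * √T with hD
  by_cases hT : 0 ≤ T
  swap
  · exact ⟨0, le_rfl, fun s hs => absurd (hs.1.trans hs.2) hT⟩
  refine ⟨3 * D * (2 * (A + D * √T)) + 4 * A ^ 2 * √T, by positivity, fun s hs t ht hst => ?_⟩
  have hts : 0 ≤ t - s := by linarith
  have htT : t - s ≤ T := by linarith [hs.1, ht.2]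
  have hπ : √(2 / π) ≤ 1 := sqrt_le_one.2 ((div_le_one pi_pos).2 two_le_pi)
  have b1 := h.abs_incCov_self_sub_le hs ht hst
  have b2 := h.abs_incCov_self_le hs ht hst
  have b3 := h.abs_integral_w_sq_sub_le hs ht hst
  set V := incCov (fun s t => w s * w t * (M s t - α ^ 2)) s t s t
  set L := √(2 / π) * w s * √(t - s) with hL
  have b4 : |L| ≤ (A + D * √T) * √(t - s) := by
    rw [abs_of_nonneg (mul_nonneg (mul_nonneg (sqrt_nonneg _) (h.w_nonneg s hs)) (sqrt_nonneg _))]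
    refine mul_le_mul_of_nonneg_right ?_ (sqrt_nonneg _)
    have : √(2 / π) * w s ≤ 1 * A := mul_le_mul hπ (h.w_le s hs) (h.w_nonneg s hs) zero_le_one
    have : 0 ≤ D * √T := by positivity
    linarith
  have eL : L ^ 2 = 2 / π * (w s ^ 2 * (t - s)) := by
    rw [hL, mul_pow, mul_pow, sq_sqrt hts, sq_sqrt (by positivity)]
    ring
  have e : 3 * V ^ 2 - 6 / π * ∫ r in s..t, w r ^ 2
      = 3 * ((V - L) * (V + L)) - 6 / π * ((∫ r in s..t, w r ^ 2) - w s ^ 2 * (t - s)) := by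
    have : (V - L) * (V + L) = V ^ 2 - L ^ 2 := by ring
    rw [this, eL]
    ring
  have c1 : |(V - L) * (V + L)| ≤ D * (t - s) * (2 * (A + D * √T) * √(t - s)) := by
    rw [abs_mul]
    exact mul_le_mul b1 ((abs_add_le _ _).trans (by linarith)) (abs_nonneg _) (by positivity)
  have c2 : |6 / π * ((∫ r in s..t, w r ^ 2) - w s ^ 2 * (t - s))|
      ≤ 2 * (2 * A ^ 2 * (t - s) * (√T * √(t - s))) := by
    rw [abs_mul, abs_of_pos (by positivity : 0 < 6 / π)]
    refine mul_le_mul ?_ (b3.trans ?_) (abs_nonneg _) zero_le_two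
    · rw [div_le_iff₀ pi_pos]; linarith [pi_gt_three]
    · refine mul_le_mul_of_nonneg_left ?_ (by positivity)
      nth_rewrite 1 [← mul_self_sqrt hts]
      exact mul_le_mul_of_nonneg_right (sqrt_le_sqrt htT) (sqrt_nonneg _)
  rw [e]
  refine (abs_sub _ _).trans ?_
  rw [abs_mul, abs_of_pos (by norm_num : (0 : ℝ) < 3)]
  nlinarith

/-- The weighted covariance of two increments in terms of the unweighted one. -/
lemma abs_incCov_le (h : CrossingEstimates M w α A T) {s t s' t' : ℝ} (hs : s ∈ Icc 0 T)
    (ht : t ∈ Icc 0 T) (hs' : s' ∈ Icc 0 T) (ht' : t' ∈ Icc 0 T) (hst : s ≤ t)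
    (hst' : s' ≤ t') :
    |incCov (fun s t => w s * w t * (M s t - α ^ 2)) s t s' t'|
      ≤ (2 * A ^ 3 + A ^ 2 * √T)
        * (|incCov M s t s' t'| + √(t - s) * (t' - s') + (t - s) * √(t' - s')) := by
  have hA := h.pos
  have hA1 := h.one_le
  have hts : 0 ≤ t - s := by linarith
  have hts' : 0 ≤ t' - s' := by linarith
  have e : incCov (fun s t => w s * w t * (M s t - α ^ 2)) s t s' t'
      = w t * w t' * incCov M s t s' t' + w t * (w t' - w s') * (M t s' - M s s')
        + (w t - w s) * w t' * (M s t' - M s s')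
        + (w t - w s) * (w t' - w s') * (M s s' - α ^ 2) := by
    simp only [incCov]; ring
  have hw : |w t - w s| ≤ A * (t - s) := by simpa [abs_of_nonneg hts] using h.w_lip s hs t ht
  have hw' : |w t' - w s'| ≤ A * (t' - s') := by
    simpa [abs_of_nonneg hts'] using h.w_lip s' hs' t' ht'
  have wt : |w t| ≤ A := by rw [abs_of_nonneg (h.w_nonneg t ht)]; exact h.w_le t ht
  have wt' : |w t'| ≤ A := by rw [abs_of_nonneg (h.w_nonneg t' ht')]; exact h.w_le t' ht'
  have a1 : |M t s' - M s s'| ≤ 2 * (A * √(t - s)) :=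
    (h.incr s hs t ht s' hs').trans (by linarith [h.small s hs t ht hst])
  have a2 : |M s t' - M s s'| ≤ 2 * (A * √(t' - s')) := by
    rw [h.symm s t', h.symm s s']
    exact (h.incr s' hs' t' ht' s hs).trans (by linarith [h.small s' hs' t' ht' hst'])
  set x := √(t - s)
  set y := √(t' - s')
  have c1 : |w t * w t' * incCov M s t s' t'| ≤ A * A * |incCov M s t s' t'| := by
    rw [abs_mul, abs_mul]; gcongr
  have c2 : |w t * (w t' - w s') * (M t s' - M s s')| ≤ A * (A * (t' - s')) * (2 * (A * x)) := by
    rw [abs_mul, abs_mul]; gcongr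
  have c3 : |(w t - w s) * w t' * (M s t' - M s s')| ≤ A * (t - s) * A * (2 * (A * y)) := by
    rw [abs_mul, abs_mul]; gcongr
  have c4 : |(w t - w s) * (w t' - w s') * (M s s' - α ^ 2)|
      ≤ A * (t - s) * (A * (t' - s')) * 1 := by
    rw [abs_mul, abs_mul]; gcongr; exact h.bound s hs s' hs'
  have c5 : (t - s) * (t' - s') ≤ √T * x * (t' - s') := by
    refine mul_le_mul_of_nonneg_right ?_ hts'
    nth_rewrite 1 [← mul_self_sqrt hts]
    exact mul_le_mul_of_nonneg_right (sqrt_le_sqrt (by linarith [hs.1, ht.2])) (sqrt_nonneg _)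
  have hx : 0 ≤ x := sqrt_nonneg _
  have hy : 0 ≤ y := sqrt_nonneg _
  have hk := abs_nonneg (incCov M s t s' t')
  have d1 : A * A * |incCov M s t s' t'| ≤ (2 * A ^ 3 + A ^ 2 * √T) * |incCov M s t s' t'| := by
    refine mul_le_mul_of_nonneg_right ?_ hk
    have : 0 ≤ A ^ 2 * √T := by positivity
    nlinarith [mul_le_mul_of_nonneg_left hA1 (sq_nonneg A)]
  have d2 := mul_le_mul_of_nonneg_left c5 (sq_nonneg A)
  have d3 : 0 ≤ A ^ 2 * √T * ((t - s) * y) := by positivity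
  rw [e]
  refine (abs_add_le _ _).trans ?_
  have := abs_add_three (w t * w t' * incCov M s t s' t')
    (w t * (w t' - w s') * (M t s' - M s s')) ((w t - w s) * w t' * (M s t' - M s s'))
  linarith

lemma abs_incCov_prob_le (h : CrossingEstimates M w α A T) {s t s' t' : ℝ} (hs : s ∈ Icc 0 T)
    (ht : t ∈ Icc 0 T) (hs' : s' ∈ Icc 0 T) (ht' : t' ∈ Icc 0 T) (hst' : s' ≤ t') :
    |incCov M s t s' t'| ≤ 4 * A * √(t' - s') := by
  have a1 := h.incr s' hs' t' ht' t ht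
  have a2 := h.incr s' hs' t' ht' s hs
  have a3 := h.small s' hs' t' ht' hst'
  have e : incCov M s t s' t' = (M t' t - M s' t) - (M t' s - M s' s) := by
    simp only [incCov]
    rw [h.symm t t', h.symm t s', h.symm s t', h.symm s s']; ring
  rw [e]
  refine (abs_sub _ _).trans ?_
  linarith

end CrossingEstimates

namespace CrossingEstimates

variable {M : ℝ → ℝ → ℝ} {w : ℝ → ℝ} {α A T : ℝ}

/-- Since increments are almost negatively correlated, their covariances are absolutely summable
up to the square root of the length of an interval. -/
lemma sum_abs_incCov_prob_le (h : CrossingEstimates M w α A T) {pt : ℕ → ℝ} (hpt : Monotone pt)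
    {n : ℕ} (hn : ∀ j ≤ n, pt j ∈ Icc 0 T) {i : ℕ} (hi : i < n) :
    ∑ j ∈ Finset.Ico (i + 1) n, |incCov M (pt i) (pt (i + 1)) (pt j) (pt (j + 1))|
      ≤ (2 * A * √T + 4) * A * √(pt (i + 1) - pt i) := by
  have hA := h.pos
  have hi0 := hn i hi.le
  have hi1 := hn (i + 1) hi
  have hii := hpt i.le_succ
  set s := pt i
  set t := pt (i + 1)
  have h0 := h.crossing_nonneg hi0 hi1
  have hsm := h.small s hi0 t hi1 hii
  have hterm : ∀ j ∈ Finset.Ico (i + 1) n, |incCov M s t (pt j) (pt (j + 1))|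
      ≤ 2 * (A * (α - M s t)) * (√(pt (j + 1) - t) - √(pt j - t))
        - ((M t (pt (j + 1)) - M s (pt (j + 1))) - (M t (pt j) - M s (pt j))) := by
    intro j hj
    rw [Finset.mem_Ico] at hj
    have hfar := h.far s hi0 t hi1 (pt j) (hn j hj.2.le) (pt (j + 1)) (hn _ hj.2) hii
      (hpt hj.1) (hpt j.le_succ)
    have he : 0 ≤ √(pt (j + 1) - t) - √(pt j - t) :=
      _root_.sub_nonneg.2 (sqrt_le_sqrt (sub_le_sub_right (hpt j.le_succ) _))
    have he' := mul_nonneg (mul_nonneg hA.le he) h0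
    rw [incCov, abs_le]
    constructor <;> nlinarith
  refine (Finset.sum_le_sum hterm).trans ?_
  rw [Finset.sum_sub_distrib, ← Finset.mul_sum,
    Finset.sum_Ico_sub (fun j => √(pt j - t)) hi,
    Finset.sum_Ico_sub (fun j => M t (pt j) - M s (pt j)) hi]
  have b1 : √(pt n - t) - √(pt (i + 1) - t) ≤ √T :=
    (sub_le_self _ (sqrt_nonneg _)).trans
      (sqrt_le_sqrt (by linarith [(hn n le_rfl).2, hi1.1]))
  have b2 := (abs_le.1 (h.incr s hi0 t hi1 (pt n) (hn n le_rfl))).1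
  have b3 := (abs_le.1 (h.incr s hi0 t hi1 (pt (i + 1)) hi1)).2
  have b4 := mul_le_mul_of_nonneg_left b1 (mul_nonneg zero_le_two (mul_nonneg hA.le h0))
  have b5 := mul_le_mul_of_nonneg_left hsm (show 0 ≤ 2 * A * √T + 4 by positivity)
  nlinarith

lemma sum_pt_sub_le {pt : ℕ → ℝ} {n : ℕ} (hn : ∀ j ≤ n, pt j ∈ Icc 0 T)
    (i : ℕ) : ∑ j ∈ Finset.Ico i n, (pt (j + 1) - pt j) ≤ T := by
  rcases le_or_gt i n with hi | hi
  · rw [Finset.sum_Ico_sub _ hi]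
    linarith [(hn i hi).1, (hn n le_rfl).2]
  · rw [Finset.Ico_eq_empty (by omega), Finset.sum_empty]
    exact (hn 0 (by omega)).1.trans (hn 0 (by omega)).2

lemma exists_sum_sum_incCov_le (h : CrossingEstimates M w α A T) :
    ∃ B, 0 ≤ B ∧ ∀ (pt : ℕ → ℝ), Monotone pt → ∀ n : ℕ, (∀ j ≤ n, pt j ∈ Icc 0 T) →
      ∀ δ, (∀ j, pt (j + 1) - pt j ≤ δ) →
      ∑ i ∈ Finset.range n, ∑ j ∈ Finset.range n,
        |incCov (fun s t => w s * w t * (M s t - α ^ 2)) (pt i) (pt (i + 1)) (pt i) (pt (i + 1))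
          * incCov (fun s t => w s * w t * (M s t - α ^ 2)) (pt j) (pt (j + 1)) (pt j) (pt (j + 1))
          * incCov (fun s t => w s * w t * (M s t - α ^ 2)) (pt i) (pt (i + 1)) (pt j) (pt (j + 1))
            ^ 2| ≤ B * δ := by
  by_cases hT : 0 ≤ T
  swap
  · exact ⟨0, le_rfl, fun pt _ n hn => absurd ((hn 0 n.zero_le).1.trans (hn 0 n.zero_le).2) hT⟩
  have hA := h.pos
  set R : ℝ → ℝ → ℝ := fun s t => w s * w t * (M s t - α ^ 2)
  obtain ⟨D, hD, hV⟩ : ∃ D, 0 ≤ D ∧ ∀ s ∈ Icc 0 T, ∀ t ∈ Icc 0 T, s ≤ t →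
      |incCov R s t s t| ≤ D * √(t - s) :=
    ⟨_, by positivity, fun s hs t ht => h.abs_incCov_self_le hs ht⟩
  set G := 2 * A ^ 3 + A ^ 2 * √T with hG
  set S := (2 * A * √T + 4) * A with hS
  set H := G * (4 * A + 2 * T) with hH
  set Q := D ^ 2 * H * G with hQ
  have hQ0 : 0 ≤ Q := by positivity
  refine ⟨D ^ 4 * T + 2 * (Q * (S + 2 * T) * T), by positivity, fun pt hpt n hn δ hδ => ?_⟩
  have hδ0 : 0 ≤ δ := (_root_.sub_nonneg.2 (hpt (Nat.le_succ 0))).trans (hδ 0)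
  set c : ℕ → ℕ → ℝ := fun i j => incCov R (pt i) (pt (i + 1)) (pt j) (pt (j + 1)) with hc
  set Δ : ℕ → ℝ := fun j => pt (j + 1) - pt j with hΔ
  have hΔ0 : ∀ j, 0 ≤ Δ j := fun j => _root_.sub_nonneg.2 (hpt j.le_succ)
  have hΔs : ∀ j, √(Δ j) * √(Δ j) = Δ j := fun j => mul_self_sqrt (hΔ0 j)
  have hsq : ∀ j, 0 ≤ √(Δ j) := fun j => sqrt_nonneg _
  set a : ℕ → ℕ → ℝ := fun i j => |c i i * c j j * c i j ^ 2| with ha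
  have hcc : ∀ i < n, |c i i| ≤ D * √(Δ i) := fun i hi =>
    hV _ (hn i hi.le) _ (hn _ hi) (hpt i.le_succ)
  have hRsymm : ∀ s t, R s t = R t s := fun s t => by simp only [R]; rw [h.symm]; ring
  have hcsymm : ∀ i j, c i j = c j i := fun i j => by
    simp only [hc, incCov]
    rw [hRsymm (pt (i + 1)) (pt (j + 1)), hRsymm (pt (i + 1)) (pt j), hRsymm (pt i) (pt (j + 1)),
      hRsymm (pt i) (pt j)]
    ring
  have hasymm : ∀ i j, a i j = a j i := fun i j => by
    simp only [ha]; rw [hcsymm i j]; congr 1; ring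
  have hdiag : ∀ i < n, a i i ≤ D ^ 4 * δ * Δ i := by
    intro i hi
    have e : a i i = |c i i| ^ 4 := by simp only [ha]; rw [← abs_pow]; congr 1; ring
    rw [e]
    calc |c i i| ^ 4 ≤ (D * √(Δ i)) ^ 4 := pow_le_pow_left₀ (abs_nonneg _) (hcc i hi) 4
      _ = D ^ 4 * ((√(Δ i) * √(Δ i)) * (√(Δ i) * √(Δ i))) := by ring
      _ = D ^ 4 * (Δ i * Δ i) := by rw [hΔs]
      _ ≤ D ^ 4 * (δ * Δ i) :=
        mul_le_mul_of_nonneg_left (mul_le_mul_of_nonneg_right (hδ i) (hΔ0 i)) (by positivity)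
      _ = _ := by ring
  have hoff : ∀ i < n, ∀ j < n, a i j ≤ Q * δ * (√(Δ i)
        * |incCov M (pt i) (pt (i + 1)) (pt j) (pt (j + 1))| + 2 * Δ i * Δ j) := by
    intro i hi j hj
    have hk := h.abs_incCov_le (hn i hi.le) (hn _ hi) (hn j hj.le) (hn _ hj) (hpt i.le_succ)
      (hpt j.le_succ)
    have hk' := h.abs_incCov_prob_le (hn i hi.le) (hn _ hi) (hn j hj.le) (hn _ hj) (hpt j.le_succ)
    set k := |incCov M (pt i) (pt (i + 1)) (pt j) (pt (j + 1))|
    change |c i j| ≤ G * (k + √(Δ i) * Δ j + Δ i * √(Δ j)) at hk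
    change k ≤ 4 * A * √(Δ j) at hk'
    have hk0 : 0 ≤ k := abs_nonneg _
    set x := √(Δ i)
    set y := √(Δ j)
    have hx : 0 ≤ x := sqrt_nonneg _
    have hy : 0 ≤ y := sqrt_nonneg _
    have ex : Δ i = x * x := (hΔs i).symm
    have ey : Δ j = y * y := (hΔs j).symm
    have hxT : x * x ≤ T := by rw [← ex]; linarith [(hn i hi.le).1, (hn _ hi).2]
    have hyT : y * y ≤ T := by rw [← ey]; linarith [(hn j hj.le).1, (hn _ hj).2]
    have hxδ : x * x ≤ δ := ex ▸ hδ i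
    have hyδ : y * y ≤ δ := ey ▸ hδ j
    have hxyT : x * y ≤ T := by nlinarith [sq_nonneg (x - y)]
    have hxyδ : x * y ≤ δ := by nlinarith [sq_nonneg (x - y)]
    rw [ex, ey] at hk ⊢
    have hkc : |c i j| ≤ H * y := by
      refine hk.trans ?_
      rw [hH, mul_assoc G (4 * A + 2 * T) y]
      have hGnn : 0 ≤ G := by positivity
      refine mul_le_mul_of_nonneg_left ?_ hGnn
      nlinarith [mul_le_mul_of_nonneg_right hxyT hy, mul_le_mul_of_nonneg_right hxT hy]
    calc a i j = |c i i| * |c j j| * (|c i j| * |c i j|) := by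
          simp only [ha]; rw [abs_mul, abs_mul, sq, abs_mul]
      _ ≤ (D * x) * (D * y) * ((H * y) * (G * (k + x * (y * y) + x * x * y))) := by
          have := hcc i hi
          have := hcc j hj
          gcongr
      _ = Q * (x * (y * y) * k + x * y * ((y * y) * (x * y) + (x * y) * (x * y))) := by
          rw [hQ]; ring
      _ ≤ Q * (x * δ * k + x * y * (δ * (x * y) + δ * (x * y))) := by gcongr
      _ = _ := by ring
  have hrow : ∀ i < n, ∑ j ∈ Finset.Ico (i + 1) n, a i j ≤ Q * (S + 2 * T) * δ * Δ i := by
    intro i hi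
    calc ∑ j ∈ Finset.Ico (i + 1) n, a i j
        ≤ ∑ j ∈ Finset.Ico (i + 1) n, Q * δ * (√(Δ i)
          * |incCov M (pt i) (pt (i + 1)) (pt j) (pt (j + 1))| + 2 * Δ i * Δ j) :=
          Finset.sum_le_sum fun j hj => hoff i hi j (Finset.mem_Ico.1 hj).2
      _ = Q * δ * (√(Δ i) * ∑ j ∈ Finset.Ico (i + 1) n,
            |incCov M (pt i) (pt (i + 1)) (pt j) (pt (j + 1))|
            + 2 * Δ i * ∑ j ∈ Finset.Ico (i + 1) n, Δ j) := by
          rw [← Finset.mul_sum, Finset.sum_add_distrib, Finset.mul_sum, Finset.mul_sum]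
      _ ≤ Q * δ * (√(Δ i) * (S * √(Δ i)) + 2 * Δ i * T) := by
          have := h.sum_abs_incCov_prob_le hpt hn hi
          have := sum_pt_sub_le hn (i + 1)
          have := hΔ0 i
          gcongr
      _ = Q * δ * (S * (√(Δ i) * √(Δ i)) + 2 * Δ i * T) := by ring
      _ = _ := by rw [hΔs]; ring
  have hsumΔ : ∑ i ∈ Finset.range n, Δ i ≤ T := by
    rw [Finset.range_eq_Ico]; exact sum_pt_sub_le hn 0
  have hupper : ∑ i ∈ Finset.range n, ∑ j ∈ Finset.range n, (if i < j then a i j else 0)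
      ≤ Q * (S + 2 * T) * δ * T := by
    calc ∑ i ∈ Finset.range n, ∑ j ∈ Finset.range n, (if i < j then a i j else 0)
        = ∑ i ∈ Finset.range n, ∑ j ∈ Finset.Ico (i + 1) n, a i j := by
          refine Finset.sum_congr rfl fun i _ => ?_
          rw [← Finset.sum_filter]
          refine Finset.sum_congr ?_ fun _ _ => rfl
          ext j
          simp only [Finset.mem_filter, Finset.mem_range, Finset.mem_Ico]
          omega
      _ ≤ ∑ i ∈ Finset.range n, Q * (S + 2 * T) * δ * Δ i :=
          Finset.sum_le_sum fun i hi => hrow i (Finset.mem_range.1 hi)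
      _ ≤ _ := by rw [← Finset.mul_sum]; gcongr
  have hdiagsum : ∑ i ∈ Finset.range n, ∑ j ∈ Finset.range n, (if i = j then a i j else 0)
      ≤ D ^ 4 * δ * T := by
    calc ∑ i ∈ Finset.range n, ∑ j ∈ Finset.range n, (if i = j then a i j else 0)
        = ∑ i ∈ Finset.range n, a i i := by
          refine Finset.sum_congr rfl fun i hi => ?_
          rw [Finset.sum_ite_eq, if_pos hi]
      _ ≤ ∑ i ∈ Finset.range n, D ^ 4 * δ * Δ i :=
          Finset.sum_le_sum fun i hi => hdiag i (Finset.mem_range.1 hi)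
      _ ≤ _ := by rw [← Finset.mul_sum]; gcongr
  have hlower : ∑ i ∈ Finset.range n, ∑ j ∈ Finset.range n, (if j < i then a i j else 0)
      ≤ Q * (S + 2 * T) * δ * T := by
    rw [Finset.sum_comm]
    refine le_trans (le_of_eq ?_) hupper
    refine Finset.sum_congr rfl fun i _ => Finset.sum_congr rfl fun j _ => ?_
    rw [hasymm]
  have hsplit : ∀ i j, a i j = (if i < j then a i j else 0) + (if i = j then a i j else 0)
      + (if j < i then a i j else 0) := by
    intro i j
    rcases lt_trichotomy i j with hij | rfl | hij
    · simp [hij, hij.ne, hij.not_gt]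
    · simp
    · simp [hij, hij.ne', hij.not_gt]
  calc ∑ i ∈ Finset.range n, ∑ j ∈ Finset.range n, a i j
      = ∑ i ∈ Finset.range n, ∑ j ∈ Finset.range n, (if i < j then a i j else 0)
        + ∑ i ∈ Finset.range n, ∑ j ∈ Finset.range n, (if i = j then a i j else 0)
        + ∑ i ∈ Finset.range n, ∑ j ∈ Finset.range n, (if j < i then a i j else 0) := by
        simp_rw [← Finset.sum_add_distrib]
        exact Finset.sum_congr rfl fun i _ => Finset.sum_congr rfl fun j _ => hsplit i j
    _ ≤ _ := by linarith

end CrossingEstimates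

section

variable {Ω : Type*} [MeasurableSpace Ω] {P : Measure Ω}

lemma integral_pow_of_map_eq_gaussianReal {Z : Ω → ℝ} (hZ : Measurable Z) {v : ℝ} (hv : 0 ≤ v)
    (h : P.map Z = gaussianReal 0 v.toNNReal) :
    (Integrable (fun ω => Z ω ^ 4) P ∧ ∫ ω, Z ω ^ 4 ∂P = 3 * v ^ 2)
      ∧ Integrable (fun ω => Z ω ^ 8) P ∧ ∫ ω, Z ω ^ 8 ∂P = 105 * v ^ 4 := by
  have i : ∀ k : ℕ, Integrable (fun ω => Z ω ^ k) P := fun k => by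
    have h1 := integrable_pow_heatLaw v k
    rw [heatLaw, ← h] at h1
    exact h1.comp_measurable hZ
  have e : ∀ k : ℕ, ∫ ω, Z ω ^ k ∂P = ∫ x, x ^ k ∂(gaussianReal 0 v.toNNReal) := fun k => by
    rw [← h, integral_map hZ.aemeasurable (by fun_prop)]
  refine ⟨⟨i 4, ?_⟩, i 8, ?_⟩
  · rw [e, integral_pow_four_gaussianReal, Real.coe_toNNReal _ hv]
  · rw [e, integral_pow_eight_gaussianReal, Real.coe_toNNReal _ hv]

/-- The covariance of the fourth powers of two jointly Gaussian centered variables. -/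
lemma integral_pow_four_centered_mul_le [IsProbabilityMeasure P] {X Y : Ω → ℝ}
    (hX : Measurable X) (hY : Measurable Y) {a b c : ℝ}
    (hnn : ∀ x y : ℝ, 0 ≤ x ^ 2 * a + 2 * x * y * c + y ^ 2 * b)
    (h : ∀ x y : ℝ, P.map (fun ω => x * X ω + y * Y ω)
      = gaussianReal 0 (x ^ 2 * a + 2 * x * y * c + y ^ 2 * b).toNNReal) :
    Integrable (fun ω => (X ω ^ 4 - 3 * a ^ 2) * (Y ω ^ 4 - 3 * b ^ 2)) P
      ∧ ∫ ω, (X ω ^ 4 - 3 * a ^ 2) * (Y ω ^ 4 - 3 * b ^ 2) ∂P ≤ 96 * |a * b * c ^ 2| := by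
  have key := fun x y => integral_pow_of_map_eq_gaussianReal (by fun_prop) (hnn x y) (h x y)
  have hX' := key 1 0
  have hY' := key 0 1
  simp only [one_mul, zero_mul, add_zero, zero_add, one_pow, mul_zero, ne_eq, OfNat.ofNat_ne_zero,
    not_false_eq_true, zero_pow, mul_one] at hX' hY'
  obtain ⟨⟨iX4, eX4⟩, iX8, eX8⟩ := hX'
  obtain ⟨⟨iY4, eY4⟩, iY8, eY8⟩ := hY'
  have k8 := fun y => (key 1 y).2
  simp only [one_mul, one_pow, mul_one] at k8
  obtain ⟨i1, e1⟩ := k8 1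
  obtain ⟨i2, e2⟩ := k8 (-1)
  obtain ⟨i3, e3⟩ := k8 2
  obtain ⟨i4, e4⟩ := k8 (-2)
  obtain ⟨i5, e5⟩ := k8 3
  obtain ⟨i6, e6⟩ := k8 (-3)
  have hpt : (fun ω => (X ω ^ 4 - 3 * a ^ 2) * (Y ω ^ 4 - 3 * b ^ 2)) = fun ω =>
      (-39 / 10080) * (X ω + 1 * Y ω) ^ 8 + (-39 / 10080) * (X ω + -1 * Y ω) ^ 8
      + 12 / 10080 * (X ω + 2 * Y ω) ^ 8 + 12 / 10080 * (X ω + -2 * Y ω) ^ 8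
      + (-1 / 10080) * (X ω + 3 * Y ω) ^ 8 + (-1 / 10080) * (X ω + -3 * Y ω) ^ 8
      + 56 / 10080 * X ω ^ 8 + 7056 / 10080 * Y ω ^ 8
      + (-3 * b ^ 2) * X ω ^ 4 + (-3 * a ^ 2) * Y ω ^ 4 + 9 * a ^ 2 * b ^ 2 := by
    ext ω; ring
  have j1 := i1.const_mul (-39 / 10080)
  have j2 := j1.add (i2.const_mul (-39 / 10080))
  have j3 := j2.add (i3.const_mul (12 / 10080))
  have j4 := j3.add (i4.const_mul (12 / 10080))
  have j5 := j4.add (i5.const_mul (-1 / 10080))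
  have j6 := j5.add (i6.const_mul (-1 / 10080))
  have j7 := j6.add (iX8.const_mul (56 / 10080))
  have j8 := j7.add (iY8.const_mul (7056 / 10080))
  have j9 := j8.add (iX4.const_mul (-3 * b ^ 2))
  have j10 := j9.add (iY4.const_mul (-3 * a ^ 2))
  have j11 := j10.add (integrable_const (9 * a ^ 2 * b ^ 2))
  have hc : c ^ 2 ≤ a * b := by
    have := discrim_le_zero (a := b) (b := 2 * c) (c := a) fun x => by
      have := hnn 1 x; nlinarith
    rw [discrim] at this
    nlinarith
  have hval : ∫ ω, (X ω ^ 4 - 3 * a ^ 2) * (Y ω ^ 4 - 3 * b ^ 2) ∂P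
      = 72 * (a * b * c ^ 2) + 24 * (c ^ 2 * c ^ 2) := by
    rw [hpt]
    refine (integral_add' j10 (integrable_const (9 * a ^ 2 * b ^ 2))).trans ?_
    rw [integral_add' j9 (iY4.const_mul (-3 * a ^ 2)), integral_add' j8 (iX4.const_mul (-3 * b ^ 2)),
      integral_add' j7 (iY8.const_mul (7056 / 10080)), integral_add' j6 (iX8.const_mul (56 / 10080)),
      integral_add' j5 (i6.const_mul (-1 / 10080)), integral_add' j4 (i5.const_mul (-1 / 10080)),
      integral_add' j3 (i4.const_mul (12 / 10080)), integral_add' j2 (i3.const_mul (12 / 10080)),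
      integral_add' j1 (i2.const_mul (-39 / 10080))]
    simp only [integral_const_mul, integral_const, probReal_univ, one_smul, e1, e2, e3, e4, e5, e6,
      eX8, eY8, eX4, eY4]
    ring
  refine ⟨hpt ▸ j11, ?_⟩
  rw [hval]
  have h1 := le_abs_self (a * b * c ^ 2)
  have h2 := mul_le_mul_of_nonneg_right hc (sq_nonneg c)
  linarith

/-- The second moment of a sum of centered fourth powers of jointly Gaussian variables. -/
lemma integral_sq_sum_pow_four_le [IsProbabilityMeasure P] {X : ℕ → Ω → ℝ}
    (hX : ∀ i, Measurable (X i)) {c : ℕ → ℕ → ℝ}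
    (hnn : ∀ i j, ∀ x y : ℝ, 0 ≤ x ^ 2 * c i i + 2 * x * y * c i j + y ^ 2 * c j j)
    (h : ∀ i j, ∀ x y : ℝ, P.map (fun ω => x * X i ω + y * X j ω)
      = gaussianReal 0 (x ^ 2 * c i i + 2 * x * y * c i j + y ^ 2 * c j j).toNNReal) (n : ℕ) :
    Integrable (fun ω => (∑ i ∈ Finset.range n, (X i ω ^ 4 - 3 * c i i ^ 2)) ^ 2) P ∧
    ∫ ω, (∑ i ∈ Finset.range n, (X i ω ^ 4 - 3 * c i i ^ 2)) ^ 2 ∂P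
      ≤ 96 * ∑ i ∈ Finset.range n, ∑ j ∈ Finset.range n, |c i i * c j j * c i j ^ 2| := by
  have key := fun i j => integral_pow_four_centered_mul_le (hX i) (hX j) (hnn i j) (h i j)
  simp_rw [sq (∑ i ∈ Finset.range n, _), Finset.sum_mul_sum]
  refine ⟨integrable_finsetSum _ fun i _ => integrable_finsetSum _ fun j _ => (key i j).1, ?_⟩
  rw [integral_finsetSum _ fun i _ => integrable_finsetSum _ fun j _ => (key i j).1, Finset.mul_sum]
  refine Finset.sum_le_sum fun i _ => ?_
  rw [integral_finsetSum _ fun j _ => (key i j).1, Finset.mul_sum]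
  exact Finset.sum_le_sum fun j _ => (key i j).2

/-- The law of a linear combination of two increments of a centered Gaussian process. -/
lemma map_increments_eq_gaussianReal {F : ℝ → Ω → ℝ} {R : ℝ → ℝ → ℝ}
    (hR : ∀ s t, 0 ≤ s → 0 ≤ t → R s t = R t s)
    (hnn : ∀ (ts : Fin 4 → ℝ), (∀ i, 0 ≤ ts i) → ∀ c : Fin 4 → ℝ,
      0 ≤ ∑ i, ∑ j, c i * c j * R (ts i) (ts j))
    (hF : ∀ (ts : Fin 4 → ℝ), (∀ i, 0 ≤ ts i) → ∀ c : Fin 4 → ℝ,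
      P.map (fun ω => ∑ i, c i * F (ts i) ω)
        = gaussianReal 0 (∑ i, ∑ j, c i * c j * R (ts i) (ts j)).toNNReal)
    {s t s' t' : ℝ} (hs : 0 ≤ s) (ht : 0 ≤ t) (hs' : 0 ≤ s') (ht' : 0 ≤ t') (x y : ℝ) :
    0 ≤ x ^ 2 * incCov R s t s t + 2 * x * y * incCov R s t s' t' + y ^ 2 * incCov R s' t' s' t' ∧
    P.map (fun ω => x * (F t ω - F s ω) + y * (F t' ω - F s' ω))
      = gaussianReal 0 (x ^ 2 * incCov R s t s t + 2 * x * y * incCov R s t s' t'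
        + y ^ 2 * incCov R s' t' s' t').toNNReal := by
  have hts : ∀ i, 0 ≤ (![s, t, s', t'] : Fin 4 → ℝ) i := by
    intro i; fin_cases i <;> simpa
  have e : ∑ i, ∑ j, (![-x, x, -y, y] : Fin 4 → ℝ) i * (![-x, x, -y, y] : Fin 4 → ℝ) j
        * R ((![s, t, s', t'] : Fin 4 → ℝ) i) ((![s, t, s', t'] : Fin 4 → ℝ) j)
      = x ^ 2 * incCov R s t s t + 2 * x * y * incCov R s t s' t'
        + y ^ 2 * incCov R s' t' s' t' := by
    simp [Fin.sum_univ_four, incCov]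
    rw [hR s' s hs' hs, hR s' t hs' ht, hR t' s ht' hs, hR t' t ht' ht]
    ring
  have h1 := hnn _ hts ![-x, x, -y, y]
  have h2 := hF _ hts ![-x, x, -y, y]
  rw [e] at h1 h2
  refine ⟨h1, ?_⟩
  rw [← h2]
  congr 1
  ext ω
  simp [Fin.sum_univ_four]
  ring

end

section

variable {Ω : Type*} {F : ℝ → Ω → ℝ} {pt : ℕ → ℝ}

lemma exists_quarticVar_eq_sum (F : ℝ → Ω → ℝ) (h0 : pt 0 = 0) (hpt : StrictMono pt)
    (hlim : Tendsto pt atTop atTop) {t : ℝ} (ht : 0 ≤ t) :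
    ∃ n, pt n ≤ t ∧ t < pt (n + 1) ∧
      ∀ ω, quarticVar F pt t ω = ∑ j ∈ Finset.range n, (F (pt (j + 1)) ω - F (pt j) ω) ^ 4 := by
  classical
  have hex : ∃ m, t < pt m := (hlim.eventually_gt_atTop t).exists
  obtain ⟨n, hn⟩ : ∃ n, Nat.find hex = n + 1 := Nat.exists_eq_succ_of_ne_zero fun h => by
    have := Nat.find_spec hex
    rw [h, h0] at this
    linarith
  have h1 : pt n ≤ t := not_lt.1 (Nat.find_min hex (by omega))
  have h2 : t < pt (n + 1) := hn ▸ Nat.find_spec hex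
  refine ⟨n, h1, h2, fun ω => ?_⟩
  rw [quarticVar, tsum_eq_sum (s := Finset.range n)]
  · refine Finset.sum_congr rfl fun j hj => if_pos ?_
    exact (hpt.monotone (Finset.mem_range.1 hj)).trans h1
  · intro j hj
    refine if_neg (not_le.2 (h2.trans_le (hpt.monotone ?_)))
    simpa using hj

lemma quarticVar_mono (h0 : pt 0 = 0) (hpt : StrictMono pt) (hlim : Tendsto pt atTop atTop)
    {s t : ℝ} (hs : 0 ≤ s) (hst : s ≤ t) (ω : Ω) :
    quarticVar F pt s ω ≤ quarticVar F pt t ω := by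
  obtain ⟨m, hm, -, em⟩ := exists_quarticVar_eq_sum F h0 hpt hlim hs
  obtain ⟨n, -, hn, en⟩ := exists_quarticVar_eq_sum F h0 hpt hlim (hs.trans hst)
  have hmn : m ≤ n := Nat.lt_succ_iff.1 (hpt.lt_iff_lt.1 (hm.trans_lt (hst.trans_lt hn)))
  rw [em, en]
  exact Finset.sum_le_sum_of_subset_of_nonneg (by simpa using hmn) fun _ _ _ => by positivity

/-- A monotone function is uniformly close to a Lipschitz function as soon as it is close to it
on a fine grid. -/
lemma sq_abs_sub_le_sum_grid {V g : ℝ → ℝ} {K T : ℝ} (hT : 0 < T) (hK : 0 ≤ K)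
    (hV : ∀ s t, 0 ≤ s → s ≤ t → V s ≤ V t)
    (hg : ∀ s ∈ Icc 0 T, ∀ t ∈ Icc 0 T, s ≤ t → |g t - g s| ≤ K * (t - s))
    {N : ℕ} (hN : 0 < N) {t : ℝ} (ht : t ∈ Icc 0 T) :
    |V t - g t| ^ 2 ≤ 2 * ∑ k ∈ Finset.range (N + 1), (V (k * (T / N)) - g (k * (T / N))) ^ 2
      + 2 * (K * (T / N)) ^ 2 := by
  have hN' : (0 : ℝ) < N := by exact_mod_cast hN
  set η := T / N with hη
  have hη0 : 0 < η := by positivity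
  have hNη : N * η = T := by rw [hη]; field_simp
  have hgrid : ∀ k ≤ N, (k : ℝ) * η ∈ Icc 0 T := fun k hk => by
    refine ⟨by positivity, ?_⟩
    rw [← hNη]
    have : (k : ℝ) ≤ N := by exact_mod_cast hk
    gcongr
  have hsum : ∀ k ≤ N, (V (k * η) - g (k * η)) ^ 2
      ≤ ∑ k ∈ Finset.range (N + 1), (V (k * η) - g (k * η)) ^ 2 := fun k hk =>
    Finset.single_le_sum (f := fun k : ℕ => (V (k * η) - g (k * η)) ^ 2)
      (fun _ _ => sq_nonneg _) (Finset.mem_range.2 (by omega))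
  have hlow : ∃ k ≤ N, (k : ℝ) * η ≤ t ∧ t - k * η ≤ η := by
    refine ⟨⌊t / η⌋₊, ?_, ?_, ?_⟩
    · refine Nat.floor_le_of_le ?_
      rw [div_le_iff₀ hη0, hNη]
      exact ht.2
    · rw [← le_div_iff₀ hη0]
      exact Nat.floor_le (div_nonneg ht.1 hη0.le)
    · have := (Nat.lt_floor_add_one (t / η)).le
      rw [div_le_iff₀ hη0] at this
      linarith
  have hupp : ∃ k ≤ N, t ≤ (k : ℝ) * η ∧ k * η - t ≤ η := by
    refine ⟨⌈t / η⌉₊, ?_, ?_, ?_⟩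
    · refine Nat.ceil_le.2 ?_
      rw [div_le_iff₀ hη0, hNη]
      exact ht.2
    · rw [← div_le_iff₀ hη0]
      exact Nat.le_ceil _
    · have := (Nat.ceil_lt_add_one (div_nonneg ht.1 hη0.le)).le
      rw [← sub_le_iff_le_add, le_div_iff₀ hη0] at this
      linarith
  have hfin : ∀ k ≤ N, |V t - g t| ≤ |V (k * η) - g (k * η)| + K * η →
      |V t - g t| ^ 2 ≤ 2 * ∑ k ∈ Finset.range (N + 1), (V (k * η) - g (k * η)) ^ 2
        + 2 * (K * η) ^ 2 := fun k hk h => by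
    have h1 := pow_le_pow_left₀ (abs_nonneg _) h 2
    have h2 := add_sq_le (a := |V (k * η) - g (k * η)|) (b := K * η)
    rw [sq_abs (V (k * η) - g (k * η))] at h2
    linarith [hsum k hk]
  rcases le_total 0 (V t - g t) with h | h
  · obtain ⟨k, hk, h1, h2⟩ := hupp
    refine hfin k hk ?_
    have h3 := hV t _ ht.1 h1
    have h4 := (abs_le.1 (hg t ht _ (hgrid k hk) h1)).2
    have h5 : K * (k * η - t) ≤ K * η := by gcongr
    rw [abs_of_nonneg h]
    linarith [le_abs_self (V (k * η) - g (k * η))]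
  · obtain ⟨k, hk, h1, h2⟩ := hlow
    refine hfin k hk ?_
    have h3 := hV _ t (hgrid k hk).1 h1
    have h4 := (abs_le.1 (hg _ (hgrid k hk) t ht h1)).2
    have h5 : K * (t - k * η) ≤ K * η := by gcongr
    rw [abs_of_nonpos h]
    linarith [neg_le_abs (V (k * η) - g (k * η))]

end

section

variable {Ω : Type*} [MeasurableSpace Ω] {P : Measure Ω} [IsProbabilityMeasure P]
  {F : ℝ → Ω → ℝ} {M : ℝ → ℝ → ℝ} {w : ℝ → ℝ} {α A T : ℝ}

namespace CrossingEstimates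

lemma abs_six_div_pi_mul_integral_sub_le (h : CrossingEstimates M w α A T) {s t : ℝ}
    (hs : s ∈ Icc 0 T) (ht : t ∈ Icc 0 T) (hst : s ≤ t) :
    |6 / π * (∫ r in (0 : ℝ)..t, w r ^ 2) - 6 / π * ∫ r in (0 : ℝ)..s, w r ^ 2|
      ≤ 2 * A ^ 2 * (t - s) := by
  have h0 : (0 : ℝ) ∈ Icc 0 T := ⟨le_rfl, hs.1.trans hs.2⟩
  have hA := h.pos
  rw [← mul_sub, intervalIntegral.integral_interval_sub_left (h.intervalIntegrable_w_sq h0 ht)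
    (h.intervalIntegrable_w_sq h0 hs), abs_mul, abs_of_nonneg (by positivity)]
  have h6 : 6 / π ≤ 2 := by
    rw [div_le_iff₀ pi_pos]
    linarith [pi_gt_three]
  have hb : |∫ r in s..t, w r ^ 2| ≤ A ^ 2 * (t - s) := by
    have := intervalIntegral.norm_integral_le_of_norm_le_const (a := s) (b := t) (C := A ^ 2)
      (f := fun r => w r ^ 2) fun r hr => by
        rw [uIoc_of_le hst] at hr
        have hr' : r ∈ Icc 0 T := ⟨hs.1.trans hr.1.le, hr.2.trans ht.2⟩
        rw [norm_pow, norm_eq_abs, sq_abs]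
        exact pow_le_pow_left₀ (h.w_nonneg r hr') (h.w_le r hr') 2
    simpa [abs_of_nonneg (sub_nonneg.2 hst)] using this
  calc 6 / π * |∫ r in s..t, w r ^ 2| ≤ 2 * (A ^ 2 * (t - s)) := by gcongr
    _ = _ := by ring

/-- `L²` convergence of the quartic variation at partition points. -/
lemma exists_integral_sq_sum_sub_le (h : CrossingEstimates M w α A T)
    (hFm : ∀ t, Measurable (F t))
    (hF : ∀ s t s' t', 0 ≤ s → 0 ≤ t → 0 ≤ s' → 0 ≤ t' → ∀ x y : ℝ,
      0 ≤ x ^ 2 * incCov (fun s t => w s * w t * (M s t - α ^ 2)) s t s t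
        + 2 * x * y * incCov (fun s t => w s * w t * (M s t - α ^ 2)) s t s' t'
        + y ^ 2 * incCov (fun s t => w s * w t * (M s t - α ^ 2)) s' t' s' t' ∧
      P.map (fun ω => x * (F t ω - F s ω) + y * (F t' ω - F s' ω))
        = gaussianReal 0 (x ^ 2 * incCov (fun s t => w s * w t * (M s t - α ^ 2)) s t s t
          + 2 * x * y * incCov (fun s t => w s * w t * (M s t - α ^ 2)) s t s' t'
          + y ^ 2 * incCov (fun s t => w s * w t * (M s t - α ^ 2)) s' t' s' t').toNNReal) :
    ∃ B, 0 ≤ B ∧ ∀ pt : ℕ → ℝ, pt 0 = 0 → Monotone pt → ∀ n, pt n ≤ T →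
      ∀ δ, (∀ j, pt (j + 1) - pt j ≤ δ) →
      Integrable (fun ω => (∑ j ∈ Finset.range n, (F (pt (j + 1)) ω - F (pt j) ω) ^ 4
        - 6 / π * ∫ r in (0 : ℝ)..pt n, w r ^ 2) ^ 2) P ∧
      ∫ ω, (∑ j ∈ Finset.range n, (F (pt (j + 1)) ω - F (pt j) ω) ^ 4
        - 6 / π * ∫ r in (0 : ℝ)..pt n, w r ^ 2) ^ 2 ∂P ≤ B * δ := by
  obtain ⟨B₁, hB₁, h₁⟩ := h.exists_sum_sum_incCov_le
  obtain ⟨B₂, hB₂, h₂⟩ := h.exists_abs_three_mul_incCov_sq_sub_le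
  refine ⟨2 * (96 * B₁) + 2 * (B₂ * T) ^ 2, by positivity, fun pt h0 hpt n hn δ hδ => ?_⟩
  set R : ℝ → ℝ → ℝ := fun s t => w s * w t * (M s t - α ^ 2)
  have hpt0 : ∀ j, 0 ≤ pt j := fun j => h0 ▸ hpt (Nat.zero_le j)
  have hmem : ∀ j ≤ n, pt j ∈ Icc 0 T := fun j hj => ⟨hpt0 j, (hpt hj).trans hn⟩
  have hδ0 : 0 ≤ δ := (sub_nonneg.2 (hpt (Nat.le_succ 0))).trans (hδ 0)
  have hT : 0 ≤ T := (hpt0 n).trans hn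
  set c : ℕ → ℕ → ℝ := fun i j => incCov R (pt i) (pt (i + 1)) (pt j) (pt (j + 1))
  obtain ⟨ia, ha⟩ := integral_sq_sum_pow_four_le (P := P)
    (X := fun i ω => F (pt (i + 1)) ω - F (pt i) ω) (c := c)
    (fun i => (hFm _).sub (hFm _))
    (fun i j x y => (hF _ _ _ _ (hpt0 _) (hpt0 _) (hpt0 _) (hpt0 _) x y).1)
    (fun i j x y => (hF _ _ _ _ (hpt0 _) (hpt0 _) (hpt0 _) (hpt0 _) x y).2) n
  replace ha := ha.trans (mul_le_mul_of_nonneg_left (h₁ pt hpt n hmem δ hδ) (by norm_num))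
  set b : ℝ := ∑ j ∈ Finset.range n, (3 * c j j ^ 2 - 6 / π * ∫ r in pt j..pt (j + 1), w r ^ 2)
    with hb
  have hbabs : |b| ≤ B₂ * T * √δ := by
    calc |b| ≤ ∑ j ∈ Finset.range n, B₂ * √δ * (pt (j + 1) - pt j) := by
          refine (Finset.abs_sum_le_sum_abs _ _).trans (Finset.sum_le_sum fun j hj => ?_)
          have hj := Finset.mem_range.1 hj
          have hd : 0 ≤ pt (j + 1) - pt j := sub_nonneg.2 (hpt j.le_succ)
          refine (h₂ _ (hmem j hj.le) _ (hmem (j + 1) hj) (hpt j.le_succ)).trans ?_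
          have : B₂ * ((pt (j + 1) - pt j) * √(pt (j + 1) - pt j))
              ≤ B₂ * ((pt (j + 1) - pt j) * √δ) := by
            gcongr
            exact hδ j
          linarith
      _ = B₂ * √δ * ∑ j ∈ Finset.Ico 0 n, (pt (j + 1) - pt j) := by
          rw [Finset.mul_sum, Finset.range_eq_Ico]
      _ ≤ B₂ * √δ * T := by
          gcongr
          exact sum_pt_sub_le hmem 0
      _ = _ := by ring
  have hbsq : b ^ 2 ≤ (B₂ * T) ^ 2 * δ := by
    rw [← sq_abs]
    calc |b| ^ 2 ≤ (B₂ * T * √δ) ^ 2 := pow_le_pow_left₀ (abs_nonneg _) hbabs 2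
      _ = _ := by rw [mul_pow, sq_sqrt hδ0]
  have hint : ∑ j ∈ Finset.range n, (∫ r in pt j..pt (j + 1), w r ^ 2)
      = ∫ r in (0 : ℝ)..pt n, w r ^ 2 := by
    rw [intervalIntegral.sum_integral_adjacent_intervals fun j hj =>
      h.intervalIntegrable_w_sq (hmem j hj.le) (hmem (j + 1) hj), h0]
  have hsplit : ∀ ω, ∑ j ∈ Finset.range n, (F (pt (j + 1)) ω - F (pt j) ω) ^ 4
        - 6 / π * ∫ r in (0 : ℝ)..pt n, w r ^ 2
      = ∑ j ∈ Finset.range n, ((F (pt (j + 1)) ω - F (pt j) ω) ^ 4 - 3 * c j j ^ 2) + b := by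
    intro ω
    rw [hb, ← hint, Finset.mul_sum, ← Finset.sum_sub_distrib, ← Finset.sum_add_distrib]
    exact Finset.sum_congr rfl fun j _ => by ring
  simp_rw [hsplit]
  have hdom : Integrable (fun ω => 2 * (∑ j ∈ Finset.range n,
      ((F (pt (j + 1)) ω - F (pt j) ω) ^ 4 - 3 * c j j ^ 2)) ^ 2 + 2 * b ^ 2) P :=
    (ia.const_mul 2).add (integrable_const _)
  have hle : ∀ ω, (∑ j ∈ Finset.range n,
        ((F (pt (j + 1)) ω - F (pt j) ω) ^ 4 - 3 * c j j ^ 2) + b) ^ 2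
      ≤ 2 * (∑ j ∈ Finset.range n,
        ((F (pt (j + 1)) ω - F (pt j) ω) ^ 4 - 3 * c j j ^ 2)) ^ 2 + 2 * b ^ 2 := fun ω => by
    linarith [add_sq_le (a := ∑ j ∈ Finset.range n,
      ((F (pt (j + 1)) ω - F (pt j) ω) ^ 4 - 3 * c j j ^ 2)) (b := b)]
  have hi : Integrable (fun ω => (∑ j ∈ Finset.range n,
      ((F (pt (j + 1)) ω - F (pt j) ω) ^ 4 - 3 * c j j ^ 2) + b) ^ 2) P := by
    refine hdom.mono' (Measurable.aestronglyMeasurable (by fun_prop)) (ae_of_all _ fun ω => ?_)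
    rw [norm_of_nonneg (sq_nonneg _)]
    exact hle ω
  refine ⟨hi, (integral_mono hi hdom hle).trans ?_⟩
  rw [integral_add (ia.const_mul 2) (integrable_const _), integral_const_mul]
  simp only [integral_const, probReal_univ, smul_eq_mul, one_mul]
  linarith

lemma exists_integral_sq_quarticVar_sub_le (h : CrossingEstimates M w α A T)
    (hFm : ∀ t, Measurable (F t))
    (hF : ∀ s t s' t', 0 ≤ s → 0 ≤ t → 0 ≤ s' → 0 ≤ t' → ∀ x y : ℝ,
      0 ≤ x ^ 2 * incCov (fun s t => w s * w t * (M s t - α ^ 2)) s t s t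
        + 2 * x * y * incCov (fun s t => w s * w t * (M s t - α ^ 2)) s t s' t'
        + y ^ 2 * incCov (fun s t => w s * w t * (M s t - α ^ 2)) s' t' s' t' ∧
      P.map (fun ω => x * (F t ω - F s ω) + y * (F t' ω - F s' ω))
        = gaussianReal 0 (x ^ 2 * incCov (fun s t => w s * w t * (M s t - α ^ 2)) s t s t
          + 2 * x * y * incCov (fun s t => w s * w t * (M s t - α ^ 2)) s t s' t'
          + y ^ 2 * incCov (fun s t => w s * w t * (M s t - α ^ 2)) s' t' s' t').toNNReal) :
    ∃ B, 0 ≤ B ∧ ∀ pt : ℕ → ℝ, pt 0 = 0 → StrictMono pt → Tendsto pt atTop atTop →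
      ∀ δ ≤ 1, (∀ j, pt (j + 1) - pt j ≤ δ) → ∀ t ∈ Icc 0 T,
      Integrable (fun ω => (quarticVar F pt t ω - 6 / π * ∫ r in (0 : ℝ)..t, w r ^ 2) ^ 2) P ∧
      ∫ ω, (quarticVar F pt t ω - 6 / π * ∫ r in (0 : ℝ)..t, w r ^ 2) ^ 2 ∂P ≤ B * δ := by
  obtain ⟨B, hB, hBd⟩ := h.exists_integral_sq_sum_sub_le hFm hF
  refine ⟨2 * B + 2 * (2 * A ^ 2) ^ 2, by positivity, fun pt h0 hpt hlim δ hδ1 hδ t ht => ?_⟩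
  obtain ⟨n, hn, hn', hV⟩ := exists_quarticVar_eq_sum F h0 hpt hlim ht.1
  have hn0 : 0 ≤ pt n := h0 ▸ hpt.monotone (Nat.zero_le n)
  have hδ0 : 0 ≤ δ := (sub_nonneg.2 (hpt.monotone (Nat.le_succ 0))).trans (hδ 0)
  obtain ⟨ia, ha⟩ := hBd pt h0 hpt.monotone n (hn.trans ht.2) δ hδ
  have hg := h.abs_six_div_pi_mul_integral_sub_le ⟨hn0, hn.trans ht.2⟩ ht hn
  set g := 6 / π * ∫ r in (0 : ℝ)..t, w r ^ 2
  set g' := 6 / π * ∫ r in (0 : ℝ)..pt n, w r ^ 2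
  have hgsq : (g - g') ^ 2 ≤ (2 * A ^ 2) ^ 2 * δ := by
    have h1 : |g - g'| ≤ 2 * A ^ 2 * δ := by
      refine hg.trans ?_
      gcongr
      linarith [hδ n]
    rw [← sq_abs]
    calc |g - g'| ^ 2 ≤ (2 * A ^ 2 * δ) ^ 2 := pow_le_pow_left₀ (abs_nonneg _) h1 2
      _ = (2 * A ^ 2) ^ 2 * (δ * δ) := by ring
      _ ≤ (2 * A ^ 2) ^ 2 * (δ * 1) := by gcongr
      _ = _ := by ring
  simp_rw [hV]
  set S : Ω → ℝ := fun ω => ∑ j ∈ Finset.range n, (F (pt (j + 1)) ω - F (pt j) ω) ^ 4 with hS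
  have hSm : Measurable S := by fun_prop
  have hdom : Integrable (fun ω => 2 * (S ω - g') ^ 2 + 2 * (g - g') ^ 2) P :=
    (ia.const_mul 2).add (integrable_const _)
  have hle : ∀ ω, (S ω - g) ^ 2 ≤ 2 * (S ω - g') ^ 2 + 2 * (g - g') ^ 2 := fun ω => by
    nlinarith [sq_nonneg ((S ω - g') + (g - g'))]
  have hi : Integrable (fun ω => (S ω - g) ^ 2) P := by
    refine hdom.mono' (Measurable.aestronglyMeasurable (by fun_prop)) (ae_of_all _ fun ω => ?_)
    rw [norm_of_nonneg (sq_nonneg _)]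
    exact hle ω
  refine ⟨hi, (integral_mono hi hdom hle).trans ?_⟩
  rw [integral_add (ia.const_mul 2) (integrable_const _), integral_const_mul]
  simp only [integral_const, probReal_univ, smul_eq_mul, one_mul]
  linarith

/-- Uniform `L²` convergence of the quartic variation. -/
lemma exists_integral_iSup_lt (h : CrossingEstimates M w α A T) (hT : 0 < T)
    (hFm : ∀ t, Measurable (F t))
    (hF : ∀ s t s' t', 0 ≤ s → 0 ≤ t → 0 ≤ s' → 0 ≤ t' → ∀ x y : ℝ,
      0 ≤ x ^ 2 * incCov (fun s t => w s * w t * (M s t - α ^ 2)) s t s t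
        + 2 * x * y * incCov (fun s t => w s * w t * (M s t - α ^ 2)) s t s' t'
        + y ^ 2 * incCov (fun s t => w s * w t * (M s t - α ^ 2)) s' t' s' t' ∧
      P.map (fun ω => x * (F t ω - F s ω) + y * (F t' ω - F s' ω))
        = gaussianReal 0 (x ^ 2 * incCov (fun s t => w s * w t * (M s t - α ^ 2)) s t s t
          + 2 * x * y * incCov (fun s t => w s * w t * (M s t - α ^ 2)) s t s' t'
          + y ^ 2 * incCov (fun s t => w s * w t * (M s t - α ^ 2)) s' t' s' t').toNNReal)
    {ε : ℝ} (hε : 0 < ε) :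
    ∃ δ > (0 : ℝ), ∀ pt : ℕ → ℝ, pt 0 = 0 → StrictMono pt → Tendsto pt atTop atTop →
      (∀ j : ℕ, pt (j + 1) - pt j ≤ δ) →
      ∫ ω, (⨆ t : Icc (0 : ℝ) T,
          |quarticVar F pt t ω - 6 / π * ∫ r in (0 : ℝ)..(t : ℝ), w r ^ 2| ^ 2) ∂P < ε := by
  obtain ⟨B, hB, hBd⟩ := h.exists_integral_sq_quarticVar_sub_le hFm hF
  obtain ⟨N, hN, hNε⟩ : ∃ N : ℕ, 0 < N ∧ 2 * (2 * A ^ 2 * (T / N)) ^ 2 < ε / 2 := by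
    have : Tendsto (fun N : ℕ => 2 * (2 * A ^ 2 * (T / N)) ^ 2) atTop
        (nhds (2 * (2 * A ^ 2 * 0) ^ 2)) :=
      (((tendsto_const_div_atTop_nhds_zero_nat T).const_mul _).pow 2).const_mul 2
    exact ((eventually_gt_atTop 0).and (this.eventually_lt_const (by simpa using hε))).exists
  set m : ℝ := 2 * ((N + 1) * B)
  have hm : 0 ≤ m := by positivity
  refine ⟨min 1 (ε / 2 / (m + 1)), by positivity, fun pt h0 hpt hlim hδ => ?_⟩
  set δ := min 1 (ε / 2 / (m + 1))
  have hδm : m * δ < ε / 2 := by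
    have h1 : δ ≤ ε / 2 / (m + 1) := min_le_right _ _
    have h2 : 0 < δ := by positivity
    rw [le_div_iff₀ (by positivity)] at h1
    linarith
  set g : ℝ → ℝ := fun t => 6 / π * ∫ r in (0 : ℝ)..t, w r ^ 2
  have hgrid : ∀ k ∈ Finset.range (N + 1), (k : ℝ) * (T / N) ∈ Icc 0 T := fun k hk => by
    have hN' : (0 : ℝ) < N := by exact_mod_cast hN
    have hk : (k : ℝ) ≤ N := by exact_mod_cast Nat.lt_succ_iff.1 (Finset.mem_range.1 hk)
    refine ⟨by positivity, ?_⟩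
    calc (k : ℝ) * (T / N) ≤ N * (T / N) := by gcongr
      _ = T := by field_simp
  have key := fun k hk => hBd pt h0 hpt hlim δ (min_le_left _ _) hδ _ (hgrid k hk)
  have isum := integrable_finsetSum (Finset.range (N + 1)) fun k hk => (key k hk).1
  have : Nonempty (Icc (0 : ℝ) T) := ⟨⟨0, le_rfl, hT.le⟩⟩
  calc _ ≤ ∫ ω, (2 * ∑ k ∈ Finset.range (N + 1),
          (quarticVar F pt (k * (T / N)) ω - g (k * (T / N))) ^ 2
          + 2 * (2 * A ^ 2 * (T / N)) ^ 2) ∂P := by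
        refine integral_mono_of_nonneg
          (ae_of_all _ fun ω => Real.iSup_nonneg fun t => by positivity)
          ((isum.const_mul 2).add (integrable_const _)) (ae_of_all _ fun ω => ?_)
        exact ciSup_le fun t => sq_abs_sub_le_sum_grid (V := fun t => quarticVar F pt t ω) (g := g)
          hT (by positivity) (fun s t hs hst => quarticVar_mono h0 hpt hlim hs hst ω)
          (fun s hs t ht hst => h.abs_six_div_pi_mul_integral_sub_le hs ht hst) hN t.2
    _ = 2 * ∑ k ∈ Finset.range (N + 1),
          (∫ ω, (quarticVar F pt (k * (T / N)) ω - g (k * (T / N))) ^ 2 ∂P)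
          + 2 * (2 * A ^ 2 * (T / N)) ^ 2 := by
        rw [integral_add (isum.const_mul 2) (integrable_const _), integral_const_mul,
          integral_finsetSum _ fun k hk => (key k hk).1]
        simp [g]
    _ ≤ 2 * ∑ k ∈ Finset.range (N + 1), B * δ + 2 * (2 * A ^ 2 * (T / N)) ^ 2 := by
        gcongr with k hk
        exact (key k hk).2
    _ = m * δ + 2 * (2 * A ^ 2 * (T / N)) ^ 2 := by
        simp only [Finset.sum_const, Finset.card_range, nsmul_eq_mul, m]
        push_cast
        ring
    _ < ε := by linarith

end CrossingEstimates

end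

end

/-- A continuous centered Gaussian process `F` with covariance `ρ` has quartic
variation `(6/π) ∫₀ᵗ u(q(s),s)⁻² ds`, uniformly on compacts in `L²`, as the mesh of the
partition tends to `0`. -/
theorem quartic_variation
    {Ω : Type*} [MeasurableSpace Ω] (P : Measure Ω) [IsProbabilityMeasure P]
    (f : SchwartzMap ℝ ℝ) (hf_nonneg : ∀ x, 0 ≤ f x) (hf_prob : ∫ x : ℝ, f x = 1)
    (α : ℝ) (hα : α ∈ Set.Ioo (0 : ℝ) 1)
    (q : ℝ → ℝ)
    (hq : ∀ t, 0 ≤ t → ∫ x in Set.Iic (q t), udens (⇑f) x t = α)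
    (hq_unique : ∀ t, 0 ≤ t → ∀ r : ℝ, (∫ x in Set.Iic r, udens (⇑f) x t = α) → r = q t)
    (hfq0 : 0 < f (q 0))
    (B : ℝ → Ω → ℝ) (hB_meas : ∀ t, Measurable (B t))
    (hBmarg : ∀ t, 0 ≤ t → ∀ a : ℝ,
      (P {ω | B t ω ≤ a}).toReal = ∫ x in Set.Iic a, udens (⇑f) x t)
    (hBjoint : ∀ s t : ℝ, 0 ≤ s → s < t → ∀ a b : ℝ,
      (P {ω | B s ω ≤ a ∧ B t ω ≤ b}).toReal
        = ∫ x in Set.Iic a, (∫ y in Set.Iic b, heatKernel (t - s) x y) * udens (⇑f) x s)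
    {Ω' : Type*} [MeasurableSpace Ω'] (P' : Measure Ω') [IsProbabilityMeasure P']
    (F : ℝ → Ω' → ℝ) (hF_meas : ∀ t, Measurable (F t))
    (hFcont : ∀ ω, Continuous fun t => F t ω)
    (hFgauss : ∀ (d : ℕ) (ts : Fin d → ℝ), (∀ i, 0 ≤ ts i) → ∀ c : Fin d → ℝ,
      Measure.map (fun ω => ∑ i, c i * F (ts i) ω) P'
        = ProbabilityTheory.gaussianReal 0
            (Real.toNNReal (∑ i, ∑ j, c i * c j * rho P B (⇑f) q α (ts i) (ts j))))
    (T : ℝ) (hT : 0 < T) :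
    ∀ ε > (0 : ℝ), ∃ δ > (0 : ℝ), ∀ pt : ℕ → ℝ,
      pt 0 = 0 → StrictMono pt → Filter.Tendsto pt Filter.atTop Filter.atTop →
      (∀ j : ℕ, pt (j + 1) - pt j ≤ δ) →
      ∫ ω, (⨆ t : Set.Icc (0 : ℝ) T,
          |quarticVar F pt t ω
            - 6 / Real.pi * ∫ s in (0 : ℝ)..(t : ℝ), ((udens (⇑f) (q s) s) ^ 2)⁻¹| ^ 2) ∂P'
        < ε := by
  obtain ⟨C, hf⟩ := f.exists_regularDensity hf_nonneg hf_prob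
  have hu : ∀ t, 0 ≤ t → ∀ x, udens f x t = heatEvolve t f x := fun t ht x =>
    udens_eq_heatEvolve f ht x
  have hq' : ∀ t, 0 ≤ t → ∫ x in Iic (q t), heatEvolve t f x = α := fun t ht => by
    rw [← hq t ht]
    simp only [hu t ht]
  have hpos : ∀ t, 0 ≤ t → 0 < heatEvolve t f (q t) := fun t ht => by
    rw [← hu t ht]
    rcases ht.eq_or_lt with rfl | ht
    · simpa [udens] using hfq0
    · exact udens_pos hf ht _
  set E : ℝ → Set Ω := fun t => {ω | B t ω ≤ q t}
  have hE : ∀ t, MeasurableSet (E t) := fun t => measurableSet_le (hB_meas t) measurable_const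
  have hEα : ∀ t, 0 ≤ t → P.real (E t) = α := fun t ht => (hBmarg t ht _).trans (hq t ht)
  have hP : ∀ s t, 0 ≤ s → s ≤ t → P.real (E s ∩ E t) = coProb f q s t := fun s t hs hst => by
    rcases hst.eq_or_lt with rfl | hst
    · rw [inter_self, hEα s hs, coProb_self hf hq' hs]
    · rw [coProb_eq_setIntegral hf hs hst]
      exact hBjoint s t hs hst _ _
  obtain ⟨A, hA⟩ := exists_crossingEstimates hf hq' hpos hT P hE hP
  set w : ℝ → ℝ := fun t => (heatEvolve t f (q t))⁻¹
  set R : ℝ → ℝ → ℝ := fun s t => w s * w t * (P.real (E s ∩ E t) - α ^ 2)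
  have hrho : ∀ s t, 0 ≤ s → 0 ≤ t → rho P B f q α s t = R s t := fun s t hs ht => by
    rw [rho, hu s hs, hu t ht, div_eq_mul_inv, mul_inv, mul_comm]
    rfl
  have hincr := fun (s t s' t' : ℝ) hs ht hs' ht' => map_increments_eq_gaussianReal (P := P')
    (F := F) (R := R)
    (fun s t _ _ => by simp only [R]; rw [inter_comm, mul_comm (w s)])
    (fun ts hts c => by
      have h := sum_sum_cov_nonneg P hE ts (fun i => hEα _ (hts i)) fun i => c i * w (ts i)
      refine h.trans_eq (Finset.sum_congr rfl fun i _ => Finset.sum_congr rfl fun j _ => ?_)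
      simp only [R]
      ring)
    (fun ts hts c => by
      rw [hFgauss 4 ts hts c]
      simp_rw [hrho _ _ (hts _) (hts _)])
    (s := s) (t := t) (s' := s') (t' := t') hs ht hs' ht'
  intro ε hε
  obtain ⟨δ, hδ, H⟩ := hA.exists_integral_iSup_lt hT hF_meas hincr hε
  refine ⟨δ, hδ, fun pt h0 hpt hlim hmesh => ?_⟩
  refine lt_of_eq_of_lt ?_ (H pt h0 hpt hlim hmesh)
  have hint : ∀ t : Icc (0 : ℝ) T,
      ∫ s in (0 : ℝ)..t, ((udens f (q s) s) ^ 2)⁻¹ = ∫ s in (0 : ℝ)..t, w s ^ 2 := fun t => by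
    refine intervalIntegral.integral_congr fun s hs => ?_
    rw [uIcc_of_le t.2.1] at hs
    simp only [w]
    rw [hu s hs.1, inv_pow]
  simp_rw [hint]
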